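/- arXiv:0705.1342 — 5 statements merged into one kernel-verified Lean document; each statement's English description precedes it below -/
import Mathlib

section
/- Let ℓ ≥ 1 be odd, n ≥ 3, and a = (a_1,…,a_n) ∈ ℝ^n with Σ_{i=1}^n a_i² = 1. Define p: S^{n-1} → ℝ by p(x) = Σ_{i=1}^n a_i p_ℓ^{(i)}(x). Then ∫_{S^{n-1}} p² dσ = 1 and ∫_{S^{n-1}} ‖∇_S p(x)‖² dσ(x) = ℓ(n + ℓ − 2). -/
open MeasureTheory Real Finset
open scoped RealInnerProductSpace

noncomputable section

/-- uniform probability measure on the unit sphere of a Euclidean space -/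
def sphereUniform (ι : Type*) [Fintype ι] :
    MeasureTheory.Measure (Metric.sphere (0 : EuclideanSpace ℝ ι) 1) :=
  ((volume : MeasureTheory.Measure (EuclideanSpace ℝ ι)).toSphere Set.univ)⁻¹ •
    (volume : MeasureTheory.Measure (EuclideanSpace ℝ ι)).toSphere

/-- spherical gradient: `∇_S h(x) = ∇h(x) − ⟨∇h(x), x⟩ x` -/
def sphGrad {ι : Type*} [Fintype ι] (h : EuclideanSpace ℝ ι → ℝ)
    (x : EuclideanSpace ℝ ι) : EuclideanSpace ℝ ι :=
  gradient h x - ⟪gradient h x, x⟫ • x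

/-- The Gegenbauer polynomial `C^k_m(t)`. -/
def gegenbauer (k : ℝ) (m : ℕ) (t : ℝ) : ℝ :=
  (2 ^ m / Real.Gamma k) * ∑ j ∈ Finset.range (m / 2 + 1),
    ((-1 : ℝ) ^ j * Real.Gamma (k + m - j) * t ^ (m - 2 * j)) /
      (2 ^ (2 * j) * (Nat.factorial j) * (Nat.factorial (m - 2 * j)))

/-- The normalizing constant `A_{n,ℓ}`, with `A² = (n−3)!ℓ!(n+2ℓ−2)/((n+ℓ−3)!(n−2))`. -/
def Aconst (n ℓ : ℕ) : ℝ :=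
  Real.sqrt (((Nat.factorial (n - 3) : ℝ) * Nat.factorial ℓ * (n + 2 * ℓ - 2)) /
    ((Nat.factorial (n + ℓ - 3) : ℝ) * (n - 2)))

/-- The eigenfunction `p_ℓ^{(i)}(x) = A_{n,ℓ} C^{(n-2)/2}_ℓ(x_i)`. -/
def pli (n ℓ : ℕ) (i : Fin n) (x : EuclideanSpace ℝ (Fin n)) : ℝ :=
  Aconst n ℓ * gegenbauer (((n : ℝ) - 2) / 2) ℓ (x i)

/-- The coefficient of `t ^ d` in the Gegenbauer polynomial of degree `d + 2 * j`. -/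
def gegenbauerCoeff (k : ℝ) (j d : ℕ) : ℝ :=
  (-1) ^ j * Real.Gamma (k + d + j) * 2 ^ d / (Real.Gamma k * j.factorial * d.factorial)

/-- The Gegenbauer polynomial as an element of `ℝ[X]`. -/
def gegenbauerPoly (k : ℝ) (m : ℕ) : Polynomial ℝ :=
  ∑ j ∈ Finset.range (m / 2 + 1), Polynomial.monomial (m - 2 * j) (gegenbauerCoeff k j (m - 2 * j))

section GegenbauerPoly

open Polynomial

theorem eval_gegenbauerPoly (k : ℝ) (m : ℕ) (t : ℝ) :
    (gegenbauerPoly k m).eval t = gegenbauer k m t := by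
  rw [gegenbauerPoly, gegenbauer, eval_finsetSum, Finset.mul_sum]
  refine Finset.sum_congr rfl fun j hj => ?_
  rw [Finset.mem_range] at hj
  obtain ⟨d, rfl⟩ : ∃ d, m = d + 2 * j := ⟨m - 2 * j, by omega⟩
  rw [Nat.add_sub_cancel, eval_monomial, gegenbauerCoeff]
  have : k + ((d + 2 * j : ℕ) : ℝ) - j = k + d + j := by push_cast; ring
  rw [this, pow_add]
  by_cases hk : Real.Gamma k = 0
  · simp [hk]
  · field_simp

theorem coeff_gegenbauerPoly (k : ℝ) (j d : ℕ) :
    (gegenbauerPoly k (d + 2 * j)).coeff d = gegenbauerCoeff k j d := by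
  simp only [gegenbauerPoly, finsetSum_coeff, coeff_monomial]
  rw [Finset.sum_eq_single j]
  · simp
  · intro i hi hij
    rw [Finset.mem_range] at hi
    rw [if_neg (by omega)]
  · intro h
    exact absurd (Finset.mem_range.2 (by omega)) h

theorem coeff_gegenbauerPoly_eq_zero (k : ℝ) {m d : ℕ} (h : ∀ j, m ≠ d + 2 * j) :
    (gegenbauerPoly k m).coeff d = 0 := by
  simp only [gegenbauerPoly, finsetSum_coeff, coeff_monomial]
  refine Finset.sum_eq_zero fun j hj => ?_
  rw [Finset.mem_range] at hj
  rw [if_neg]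
  have := h j
  omega

theorem coeff_X_mul_derivative (p : ℝ[X]) (d : ℕ) :
    (X * derivative p).coeff d = d * p.coeff d := by
  cases d with
  | zero => simp
  | succ d => rw [coeff_X_mul, coeff_derivative]; push_cast; ring

theorem gegenbauerCoeff_degree_step {k : ℝ} (hk : 0 < k) (j d : ℕ) :
    (d + 2) * (d + 1) * gegenbauerCoeff k j (d + 2) +
      4 * (j + 1) * (k + d + 1 + j) * gegenbauerCoeff k (j + 1) d = 0 := by
  simp only [gegenbauerCoeff, Nat.factorial_succ]
  have hG : Real.Gamma (k + ((d + 2 : ℕ) : ℝ) + j) =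
      (k + d + 1 + j) * Real.Gamma (k + d + 1 + j) := by
    rw [← Real.Gamma_add_one (by positivity)]; congr 1; push_cast; ring
  have hG' : k + d + ((j + 1 : ℕ) : ℝ) = k + d + 1 + j := by push_cast; ring
  have := (Real.Gamma_pos_of_pos hk).ne'
  rw [hG, hG']
  push_cast
  field_simp
  ring

theorem gegenbauerCoeff_zero_succ {k : ℝ} (hk : 0 < k) (m : ℕ) :
    (m + 1) * gegenbauerCoeff k 0 (m + 1) = 2 * (m + k) * gegenbauerCoeff k 0 m := by
  simp only [gegenbauerCoeff, Nat.factorial_succ]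
  have hG : Real.Gamma (k + ((m + 1 : ℕ) : ℝ) + (0 : ℕ)) = (k + m) * Real.Gamma (k + m) := by
    rw [← Real.Gamma_add_one (by positivity)]; congr 1; push_cast; ring
  have := (Real.Gamma_pos_of_pos hk).ne'
  rw [hG]
  push_cast
  field_simp
  ring_nf

theorem gegenbauerCoeff_succ_zero {k : ℝ} (hk : 0 < k) (j : ℕ) :
    (j + 1) * gegenbauerCoeff k (j + 1) 0 = -(j + k) * gegenbauerCoeff k j 0 := by
  simp only [gegenbauerCoeff, Nat.factorial_succ]
  have hG : Real.Gamma (k + (0 : ℕ) + ((j + 1 : ℕ) : ℝ)) = (k + j) * Real.Gamma (k + j) := by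
    rw [← Real.Gamma_add_one (by positivity)]; congr 1; push_cast; ring
  have := (Real.Gamma_pos_of_pos hk).ne'
  rw [hG]
  push_cast
  field_simp
  ring_nf

theorem gegenbauerCoeff_succ_succ {k : ℝ} (hk : 0 < k) (j d : ℕ) :
    (d + 2 * j + 3) * gegenbauerCoeff k (j + 1) (d + 1) =
      2 * (d + 2 * j + 2 + k) * gegenbauerCoeff k (j + 1) d -
        (d + 2 * j + 1 + 2 * k) * gegenbauerCoeff k j (d + 1) := by
  simp only [gegenbauerCoeff, Nat.factorial_succ]
  have hG : Real.Gamma (k + ((d + 1 : ℕ) : ℝ) + ((j + 1 : ℕ) : ℝ)) =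
      (k + d + 1 + j) * Real.Gamma (k + d + 1 + j) := by
    rw [← Real.Gamma_add_one (by positivity)]; congr 1; push_cast; ring
  have hG' : k + d + ((j + 1 : ℕ) : ℝ) = k + d + 1 + j := by push_cast; ring
  have hG'' : k + ((d + 1 : ℕ) : ℝ) + j = k + d + 1 + j := by push_cast; ring
  have := (Real.Gamma_pos_of_pos hk).ne'
  rw [hG, hG', hG'']
  push_cast
  field_simp
  ring

theorem gegenbauerPoly_zero {k : ℝ} (hk : 0 < k) : gegenbauerPoly k 0 = 1 := by
  have := (Real.Gamma_pos_of_pos hk).ne'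
  simp [gegenbauerPoly, gegenbauerCoeff, this]

theorem gegenbauerPoly_one {k : ℝ} (hk : 0 < k) : gegenbauerPoly k 1 = C (2 * k) * X := by
  have h := gegenbauerCoeff_zero_succ hk 0
  have := (Real.Gamma_pos_of_pos hk).ne'
  have h0 : gegenbauerCoeff k 0 0 = 1 := by simp [gegenbauerCoeff, this]
  simp only [h0, Nat.cast_zero, zero_add, one_mul, mul_one] at h
  rw [C_mul_X_eq_monomial]
  simp [gegenbauerPoly, h]

theorem gegenbauerPoly_add_two {k : ℝ} (hk : 0 < k) (m : ℕ) :
    C ((m : ℝ) + 2) * gegenbauerPoly k (m + 2) =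
      C (2 * (m + 1 + k)) * (X * gegenbauerPoly k (m + 1)) -
        C (m + 2 * k) * gegenbauerPoly k m := by
  ext d
  simp only [coeff_sub, coeff_C_mul]
  by_cases h : ∃ j, m + 2 = d + 2 * j
  · obtain ⟨j, hj⟩ := h
    rcases j with _ | j
    · obtain rfl : d = m + 2 := by omega
      have h1 := coeff_gegenbauerPoly k 0 (m + 1)
      have h2 := coeff_gegenbauerPoly k 0 (m + 2)
      rw [mul_zero, add_zero] at h1 h2
      rw [coeff_X_mul, h1, h2, coeff_gegenbauerPoly_eq_zero k (m := m) (by omega)]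
      have := gegenbauerCoeff_zero_succ hk (m + 1)
      push_cast at this
      linear_combination this
    · rcases d with _ | d
      · obtain rfl : m = 0 + 2 * j := by omega
        have h1 := coeff_gegenbauerPoly k (j + 1) 0
        rw [show 0 + 2 * (j + 1) = 0 + 2 * j + 2 by ring] at h1
        rw [coeff_X_mul_zero, h1, coeff_gegenbauerPoly]
        push_cast
        linear_combination 2 * gegenbauerCoeff_succ_zero hk j
      · obtain rfl : m = d + 1 + 2 * j := by omega
        have h1 := coeff_gegenbauerPoly k (j + 1) (d + 1)
        have h2 := coeff_gegenbauerPoly k (j + 1) d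
        rw [show d + 1 + 2 * (j + 1) = d + 1 + 2 * j + 2 by ring] at h1
        rw [show d + 2 * (j + 1) = d + 1 + 2 * j + 1 by ring] at h2
        rw [coeff_X_mul, h1, h2, coeff_gegenbauerPoly]
        push_cast
        linear_combination gegenbauerCoeff_succ_succ hk j d
  · push Not at h
    rw [coeff_gegenbauerPoly_eq_zero k h, coeff_gegenbauerPoly_eq_zero k (m := m)
      fun j hj => h (j + 1) (by omega)]
    rcases d with _ | d
    · simp
    · rw [coeff_X_mul, coeff_gegenbauerPoly_eq_zero k (m := m + 1) fun j hj => h j (by omega)]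
      ring

theorem gegenbauerPoly_ode {k : ℝ} (hk : 0 < k) (m : ℕ) :
    (1 - X ^ 2) * derivative (derivative (gegenbauerPoly k m)) -
      C (2 * k + 1) * (X * derivative (gegenbauerPoly k m)) =
        -(C (m * (m + 2 * k)) * gegenbauerPoly k m) := by
  set p := gegenbauerPoly k m with hp
  have key : (1 - X ^ 2) * derivative (derivative p) - C (2 * k + 1) * (X * derivative p) =
      derivative (derivative p) - X * derivative (X * derivative p) -
        C (2 * k) * (X * derivative p) := by
    simp only [derivative_mul, derivative_X, C_add, C_1]
    ring
  rw [key]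
  ext d
  simp only [coeff_sub, coeff_C_mul, coeff_X_mul_derivative, coeff_neg, coeff_derivative]
  push_cast
  by_cases h : ∃ j, m = d + 2 * j
  · obtain ⟨j, rfl⟩ := h
    rw [hp, coeff_gegenbauerPoly]
    rcases j with _ | j
    · rw [coeff_gegenbauerPoly_eq_zero k (by omega)]
      push_cast
      ring
    · have h1 := coeff_gegenbauerPoly k j (d + 2)
      rw [show d + 2 + 2 * j = d + 2 * (j + 1) by ring] at h1
      rw [h1]
      push_cast
      linear_combination gegenbauerCoeff_degree_step hk j d
  · push Not at h
    rw [hp, coeff_gegenbauerPoly_eq_zero k h, coeff_gegenbauerPoly_eq_zero k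
      fun j hj => h (j + 1) (by omega)]
    ring

theorem gegenbauerPoly_comp_neg_X (k : ℝ) {m : ℕ} (hm : Odd m) :
    (gegenbauerPoly k m).comp (-X) = -gegenbauerPoly k m := by
  rw [gegenbauerPoly, Polynomial.sum_comp, ← Finset.sum_neg_distrib]
  refine Finset.sum_congr rfl fun j hj => ?_
  rw [Finset.mem_range] at hj
  have : Odd (m - 2 * j) := by
    obtain ⟨r, rfl⟩ := hm
    exact ⟨r - j, by omega⟩
  rw [monomial_comp, this.neg_pow, ← C_mul_X_pow_eq_monomial]
  ring

end GegenbauerPoly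

section GegenbauerFunctional

open Polynomial

variable {k : ℝ} (L : ℝ[X] →ₗ[ℝ] ℝ)

theorem gegenbauer_orthogonal (hk : 0 < k)
    (hL : ∀ f, L ((1 - X ^ 2) * derivative f - C (2 * k + 1) * (X * f)) = 0) (m : ℕ) :
    L (gegenbauerPoly k m * gegenbauerPoly k (m + 2)) = 0 := by
  set p := gegenbauerPoly k m with hp
  set q := gegenbauerPoly k (m + 2) with hq
  have h1 := gegenbauerPoly_ode hk m
  have h2 := gegenbauerPoly_ode hk (m + 2)
  rw [← hp] at h1
  rw [← hq] at h2
  have h3 := hL (p * derivative q - q * derivative p)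
  have h4 : (1 - X ^ 2) * derivative (p * derivative q - q * derivative p) -
      C (2 * k + 1) * (X * (p * derivative q - q * derivative p)) =
      C (m * (m + 2 * k)  - ((m + 2 : ℕ) : ℝ) * (((m + 2 : ℕ) : ℝ) + 2 * k)) * (p * q) := by
    rw [C_sub]
    simp only [derivative_mul, derivative_sub]
    linear_combination p * h2 - q * h1
  rw [h4, ← smul_eq_C_mul, map_smul, smul_eq_mul] at h3
  refine (mul_eq_zero.1 h3).resolve_left (ne_of_lt ?_)
  push_cast
  have : (0 : ℝ) ≤ m := m.cast_nonneg
  nlinarith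

theorem gegenbauer_derivative_sq (hk : 0 < k)
    (hL : ∀ f, L ((1 - X ^ 2) * derivative f - C (2 * k + 1) * (X * f)) = 0) (m : ℕ) :
    L ((1 - X ^ 2) * derivative (gegenbauerPoly k m) ^ 2) =
      m * (m + 2 * k) * L (gegenbauerPoly k m ^ 2) := by
  set p := gegenbauerPoly k m with hp
  have h1 := gegenbauerPoly_ode hk m
  rw [← hp] at h1
  have h3 := hL (p * derivative p)
  have h4 : (1 - X ^ 2) * derivative (p * derivative p) -
      C (2 * k + 1) * (X * (p * derivative p)) =
      (1 - X ^ 2) * derivative p ^ 2 - C (m * (m + 2 * k)) * p ^ 2 := by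
    simp only [derivative_mul]
    linear_combination p * h1
  rw [h4, ← smul_eq_C_mul, map_sub, map_smul, smul_eq_mul] at h3
  linarith

theorem gegenbauer_mul_succ (hk : 0 < k)
    (hL : ∀ f, L ((1 - X ^ 2) * derivative f - C (2 * k + 1) * (X * f)) = 0) (m : ℕ) :
    2 * (m + 1 + k) * L (X * gegenbauerPoly k m * gegenbauerPoly k (m + 1)) =
      (m + 2 * k) * L (gegenbauerPoly k m ^ 2) := by
  have h : C ((m : ℝ) + 2) * (gegenbauerPoly k m * gegenbauerPoly k (m + 2)) =
      C (2 * (m + 1 + k)) * (X * gegenbauerPoly k m * gegenbauerPoly k (m + 1)) -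
        C (m + 2 * k) * gegenbauerPoly k m ^ 2 := by
    linear_combination gegenbauerPoly k m * gegenbauerPoly_add_two hk m
  replace h := congrArg L h
  simp only [← smul_eq_C_mul, map_sub, map_smul, smul_eq_mul, gegenbauer_orthogonal L hk hL] at h
  linarith

theorem gegenbauer_sq_succ (hk : 0 < k)
    (hL : ∀ f, L ((1 - X ^ 2) * derivative f - C (2 * k + 1) * (X * f)) = 0) (m : ℕ) :
    (m + 1) * L (gegenbauerPoly k (m + 1) ^ 2) =
      2 * (m + k) * L (X * gegenbauerPoly k m * gegenbauerPoly k (m + 1)) := by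
  rcases m with _ | m
  · rw [gegenbauerPoly_zero hk, zero_add, gegenbauerPoly_one hk, mul_pow, ← C_pow, mul_one,
      mul_left_comm, ← sq, ← smul_eq_C_mul, ← smul_eq_C_mul, map_smul, map_smul]
    simp only [smul_eq_mul]
    push_cast
    ring
  · have h : C ((m : ℝ) + 2) * gegenbauerPoly k (m + 2) ^ 2 =
        C (2 * (m + 1 + k)) * (X * gegenbauerPoly k (m + 1) * gegenbauerPoly k (m + 2)) -
          C (m + 2 * k) * (gegenbauerPoly k m * gegenbauerPoly k (m + 2)) := by
      linear_combination gegenbauerPoly k (m + 2) * gegenbauerPoly_add_two hk m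
    replace h := congrArg L h
    simp only [← smul_eq_C_mul, map_sub, map_smul, smul_eq_mul,
      gegenbauer_orthogonal L hk hL] at h
    push_cast
    linarith

theorem gegenbauer_sq (N : ℕ) (h1 : L 1 = 1) (hk : k = (N + 1) / 2)
    (hL : ∀ f, L ((1 - X ^ 2) * derivative f - C (2 * k + 1) * (X * f)) = 0) (m : ℕ) :
    L (gegenbauerPoly k m ^ 2) * (m + k) * m.factorial * N.factorial =
      k * (N + m).factorial := by
  have hk0 : 0 < k := by rw [hk]; positivity
  induction m with
  | zero => rw [gegenbauerPoly_zero hk0, one_pow, h1]; simp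
  | succ m ih =>
    have a1 := gegenbauer_mul_succ L hk0 hL m
    have a2 := gegenbauer_sq_succ L hk0 hL m
    have a3 : ((m : ℝ) + 2 * k) = N + m + 1 := by rw [hk]; ring
    rw [a3] at a1
    rw [← add_assoc, Nat.factorial_succ, Nat.factorial_succ]
    push_cast
    linear_combination (m + 1 + k) * m.factorial * N.factorial * a2 +
      (m + k) * m.factorial * N.factorial * a1 + (N + m + 1) * ih

end GegenbauerFunctional

section SphereIntegral

theorem integral_polar {E : Type*} [NormedAddCommGroup E] [NormedSpace ℝ E] [MeasurableSpace E]
    [BorelSpace E] [FiniteDimensional ℝ E] [Nontrivial E] (μ : Measure E) [μ.IsAddHaarMeasure]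
    (g : E → ℝ) (φ : ℝ → ℝ) :
    ∫ x, g (‖x‖⁻¹ • x) * φ ‖x‖ ∂μ = (∫ s : Metric.sphere (0 : E) 1, g s ∂μ.toSphere) *
      ∫ r in Set.Ioi (0 : ℝ), r ^ (Module.finrank ℝ E - 1) * φ r := by
  calc
    _ = ∫ x : ({(0)}ᶜ : Set E), g (‖x.1‖⁻¹ • x.1) * φ ‖x.1‖ ∂(μ.comap (↑)) := by
      rw [integral_subtype_comap (measurableSet_singleton _).compl
        fun x ↦ g (‖x‖⁻¹ • x) * φ ‖x‖, restrict_compl_singleton]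
    _ = ∫ x : Metric.sphere (0 : E) 1 × Set.Ioi (0 : ℝ), g x.1 * φ x.2
          ∂μ.toSphere.prod (.volumeIoiPow (Module.finrank ℝ E - 1)) := by
      simpa using μ.measurePreserving_homeomorphUnitSphereProd.integral_comp
        (Homeomorph.measurableEmbedding _)
        (fun x : Metric.sphere (0 : E) 1 × Set.Ioi (0 : ℝ) => g x.1 * φ x.2)
    _ = (∫ s : Metric.sphere (0 : E) 1, g s ∂μ.toSphere) *
          ∫ x : Set.Ioi (0 : ℝ), φ x ∂.volumeIoiPow (Module.finrank ℝ E - 1) :=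
      integral_prod_mul (fun s : Metric.sphere (0 : E) 1 => g s) fun x : Set.Ioi (0 : ℝ) => φ x
    _ = _ := by
      congr 1
      simp only [Measure.volumeIoiPow, ENNReal.ofReal]
      rw [integral_withDensity_eq_integral_smul,
        integral_subtype_comap measurableSet_Ioi
          fun a ↦ Real.toNNReal (a ^ (Module.finrank ℝ E - 1)) • φ a,
        setIntegral_congr_fun measurableSet_Ioi fun x hx ↦ ?_]
      · rw [NNReal.smul_def, Real.coe_toNNReal _ (pow_nonneg hx.out.le _), smul_eq_mul]
      · exact (measurable_subtype_coe.pow_const _).real_toNNReal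

theorem integral_pow_mul_exp_neg_sq (s : ℕ) :
    ∫ r in Set.Ioi (0 : ℝ), r ^ s * Real.exp (-r ^ 2) = Real.Gamma ((s + 1) / 2) / 2 := by
  have := integral_rpow_mul_exp_neg_rpow (p := 2) (q := s) two_pos
    (lt_of_lt_of_le (by norm_num) s.cast_nonneg)
  simp only [Real.rpow_natCast, Real.rpow_two] at this
  rw [this]
  ring

theorem integral_even_pow_mul_exp_neg_sq (q : ℕ) :
    ∫ r : ℝ, r ^ (2 * q) * Real.exp (-r ^ 2) = Real.Gamma (q + 1 / 2) := by
  have := integral_comp_abs (f := fun r : ℝ => r ^ (2 * q) * Real.exp (-r ^ 2))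
  simp only [pow_mul, sq_abs] at this
  simp only [pow_mul]
  rw [this]
  have h := integral_pow_mul_exp_neg_sq (2 * q)
  simp only [pow_mul] at h
  rw [h]
  push_cast
  rw [show ((2 : ℝ) * q + 1) / 2 = q + 1 / 2 by ring]
  ring

variable {ι : Type*} [Fintype ι]

theorem integral_toSphere_comp_linearIsometryEquiv {E : Type*} [NormedAddCommGroup E]
    [InnerProductSpace ℝ E] [MeasurableSpace E] [BorelSpace E] [FiniteDimensional ℝ E]
    [Nontrivial E] (R : E ≃ₗᵢ[ℝ] E) (g : E → ℝ) :
    ∫ s : Metric.sphere (0 : E) 1, g (R s) ∂(volume : Measure E).toSphere =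
      ∫ s : Metric.sphere (0 : E) 1, g s ∂(volume : Measure E).toSphere := by
  have h1 := integral_polar (volume : Measure E) g fun r => Real.exp (-r ^ 2)
  have h2 := integral_polar (volume : Measure E) (fun x => g (R x)) fun r => Real.exp (-r ^ 2)
  have h3 := R.measurePreserving.integral_comp R.toHomeomorph.measurableEmbedding
    (fun x => g (‖x‖⁻¹ • x) * Real.exp (-‖x‖ ^ 2))
  simp only [LinearIsometryEquiv.norm_map, ← map_smul] at h3
  rw [h1, h2] at h3
  refine mul_right_cancel₀ ?_ h3
  rw [integral_pow_mul_exp_neg_sq]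
  have := Real.Gamma_pos_of_pos
    (show 0 < (((Module.finrank ℝ E - 1 : ℕ) : ℝ) + 1) / 2 by positivity)
  positivity

theorem integral_coord_pow_mul_exp_neg_norm_sq (i : ι) (q : ℕ) :
    ∫ x : EuclideanSpace ℝ ι, x i ^ (2 * q) * Real.exp (-‖x‖ ^ 2) =
      Real.Gamma (q + 1 / 2) * Real.Gamma (1 / 2) ^ (Fintype.card ι - 1) := by
  classical
  rw [← (PiLp.volume_preserving_toLp ι).integral_comp
    (MeasurableEquiv.toLp 2 _).measurableEmbedding]
  have h : ∀ x : ι → ℝ, (WithLp.toLp 2 x : EuclideanSpace ℝ ι) i ^ (2 * q) *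
      Real.exp (-‖(WithLp.toLp 2 x : EuclideanSpace ℝ ι)‖ ^ 2) =
      ∏ k, (x k ^ (2 * if k = i then q else 0) * Real.exp (-x k ^ 2)) := by
    intro x
    rw [Finset.prod_mul_distrib, ← Real.exp_sum, EuclideanSpace.norm_sq_eq]
    simp [Finset.prod_ite_eq', mul_ite, pow_ite, sq_abs]
  simp only [h]
  rw [integral_fintype_prod_volume_eq_prod
    (fun k (t : ℝ) => t ^ (2 * if k = i then q else 0) * Real.exp (-t ^ 2))]
  simp only [integral_even_pow_mul_exp_neg_sq]
  rw [← Finset.mul_prod_erase _ _ (Finset.mem_univ i), if_pos rfl,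
    Finset.prod_congr rfl fun k hk => by rw [if_neg (Finset.ne_of_mem_erase hk)]]
  simp [Finset.card_erase_of_mem]

theorem toSphere_even_moment [Nonempty ι] (i : ι) (q : ℕ) :
    (∫ s : Metric.sphere (0 : EuclideanSpace ℝ ι) 1, s.1 i ^ (2 * q)
        ∂(volume : Measure (EuclideanSpace ℝ ι)).toSphere) *
      (Real.Gamma (q + Fintype.card ι / 2) / 2) =
      Real.Gamma (q + 1 / 2) * Real.Gamma (1 / 2) ^ (Fintype.card ι - 1) := by
  have h1 := integral_polar (volume : Measure (EuclideanSpace ℝ ι)) (fun x => x i ^ (2 * q))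
    fun r => r ^ (2 * q) * Real.exp (-r ^ 2)
  have hc : 0 < Fintype.card ι := Fintype.card_pos
  simp only [← mul_assoc, ← pow_add, finrank_euclideanSpace, integral_pow_mul_exp_neg_sq] at h1
  rw [← integral_coord_pow_mul_exp_neg_norm_sq i q]
  have h2 : ((Fintype.card ι - 1 + 2 * q : ℕ) + 1 : ℝ) / 2 = q + Fintype.card ι / 2 := by
    push_cast [Nat.cast_sub hc]
    ring
  rw [h2] at h1
  rw [← h1]
  congr 1
  ext x
  by_cases hx : x = 0
  · rcases q with _ | q
    · simp
    · simp [hx]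
  · have : ‖x‖ ≠ 0 := norm_ne_zero_iff.2 hx
    rw [PiLp.smul_apply, smul_eq_mul, mul_pow, mul_right_comm _ _ (‖x‖ ^ _), ← mul_pow,
      inv_mul_cancel₀ this, one_pow, one_mul]

instance [Nonempty ι] : IsProbabilityMeasure (sphereUniform ι) := by
  refine ⟨?_⟩
  rw [sphereUniform, Measure.smul_apply, smul_eq_mul, ENNReal.inv_mul_cancel]
  · exact (Measure.measure_univ_ne_zero).2 (Measure.toSphere_ne_zero _)
  · exact measure_ne_top _ _

theorem integral_sphereUniform (g : Metric.sphere (0 : EuclideanSpace ℝ ι) 1 → ℝ) :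
    ∫ s, g s ∂sphereUniform ι = ((volume : Measure (EuclideanSpace ℝ ι)).toSphere.real Set.univ)⁻¹ *
      ∫ s, g s ∂(volume : Measure (EuclideanSpace ℝ ι)).toSphere := by
  rw [sphereUniform, integral_smul_measure, ENNReal.toReal_inv, smul_eq_mul, Measure.real]

theorem sphereUniform_moment_add_two [Nonempty ι] (i : ι) (q : ℕ) :
    (2 * q + Fintype.card ι) * ∫ s, s.1 i ^ (2 * (q + 1)) ∂sphereUniform ι =
      (2 * q + 1) * ∫ s, s.1 i ^ (2 * q) ∂sphereUniform ι := by
  have h0 := toSphere_even_moment i q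
  have h1 := toSphere_even_moment i (q + 1)
  have hc : (0 : ℝ) < Fintype.card ι := by exact_mod_cast Fintype.card_pos
  have hG := Real.Gamma_pos_of_pos (show 0 < q + (Fintype.card ι : ℝ) / 2 by positivity)
  push_cast at h1
  rw [add_right_comm, Real.Gamma_add_one (by positivity), add_right_comm,
    Real.Gamma_add_one (by positivity)] at h1
  rw [integral_sphereUniform, integral_sphereUniform]
  refine mul_right_cancel₀ hG.ne' ?_
  set c := ((volume : Measure (EuclideanSpace ℝ ι)).toSphere.real Set.univ)⁻¹
  linear_combination 4 * c * h1 - (2 * q + 1) * 2 * c * h0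

/-- The reflection of Euclidean space flipping the sign of the `i`-th coordinate. -/
def coordReflection [DecidableEq ι] (i : ι) : EuclideanSpace ℝ ι ≃ₗᵢ[ℝ] EuclideanSpace ℝ ι :=
  LinearIsometryEquiv.piLpCongrRight 2 fun k =>
    if k = i then LinearIsometryEquiv.neg ℝ else LinearIsometryEquiv.refl ℝ ℝ

theorem coordReflection_self [DecidableEq ι] (i : ι) (x : EuclideanSpace ℝ ι) :
    coordReflection i x i = -x i := by
  simp [coordReflection]

theorem coordReflection_ne [DecidableEq ι] {i k : ι} (h : k ≠ i) (x : EuclideanSpace ℝ ι) :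
    coordReflection i x k = x k := by
  simp [coordReflection, h]

theorem integral_sphereUniform_eq_zero_of_odd [DecidableEq ι] [Nonempty ι] (i : ι)
    (g : EuclideanSpace ℝ ι → ℝ) (hg : ∀ x, g (coordReflection i x) = -g x) :
    ∫ s, g s ∂sphereUniform ι = 0 := by
  have h := integral_toSphere_comp_linearIsometryEquiv (coordReflection i) g
  simp only [hg, integral_neg] at h
  rw [integral_sphereUniform, show ∫ s : Metric.sphere (0 : EuclideanSpace ℝ ι) 1, g s
    ∂(volume : Measure (EuclideanSpace ℝ ι)).toSphere = 0 by linarith, mul_zero]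

theorem sphereUniform_odd_moment [Nonempty ι] (i : ι) {m : ℕ} (hm : Odd m) :
    ∫ s, s.1 i ^ m ∂sphereUniform ι = 0 := by
  classical
  refine integral_sphereUniform_eq_zero_of_odd i (fun x => x i ^ m) fun x => ?_
  rw [coordReflection_self, hm.neg_pow]

theorem integrable_sphereUniform [Nonempty ι] {g : EuclideanSpace ℝ ι → ℝ} (hg : Continuous g) :
    Integrable (fun s : Metric.sphere (0 : EuclideanSpace ℝ ι) 1 => g s) (sphereUniform ι) :=
  (hg.comp continuous_subtype_val).integrable_of_hasCompactSupport
    (HasCompactSupport.of_compactSpace _)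

open Polynomial

/-- The integral over the sphere of a polynomial in one coordinate. -/
def sphereCoordIntegral [Nonempty ι] (i : ι) : ℝ[X] →ₗ[ℝ] ℝ where
  toFun f := ∫ s, f.eval (s.1 i) ∂sphereUniform ι
  map_add' f g := by
    simp only [eval_add]
    exact integral_add (integrable_sphereUniform (g := fun x => f.eval (x i)) (by fun_prop))
      (integrable_sphereUniform (g := fun x => g.eval (x i)) (by fun_prop))
  map_smul' c f := by simp [integral_const_mul]

theorem sphereCoordIntegral_apply [Nonempty ι] (i : ι) (f : ℝ[X]) :
    sphereCoordIntegral i f = ∫ s, f.eval (s.1 i) ∂sphereUniform ι := rfl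

theorem sphereCoordIntegral_one [Nonempty ι] (i : ι) : sphereCoordIntegral i 1 = 1 := by
  simp [sphereCoordIntegral_apply]

theorem sphereCoordIntegral_X_pow [Nonempty ι] (i : ι) (m : ℕ) :
    sphereCoordIntegral i (X ^ m) = ∫ s, s.1 i ^ m ∂sphereUniform ι := by
  simp [sphereCoordIntegral_apply]

theorem sphereCoordIntegral_by_parts [Nonempty ι] (i : ι) (f : ℝ[X]) :
    sphereCoordIntegral i ((1 - X ^ 2) * derivative f -
      C ((Fintype.card ι : ℝ) - 1) * (X * f)) = 0 := by
  induction f using Polynomial.induction_on' with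
  | add p q hp hq =>
    rw [← add_zero (0 : ℝ)]
    nth_rewrite 1 [← hp]
    rw [← hq, ← map_add]
    congr 1
    rw [derivative_add]
    ring
  | monomial m a =>
    have key : (1 - X ^ 2) * derivative (monomial m a) -
        C ((Fintype.card ι : ℝ) - 1) * (X * monomial m a) =
        (a * m) • X ^ (m - 1) - (a * (m + Fintype.card ι - 1)) • X ^ (m + 1) := by
      rw [derivative_monomial, ← C_mul_X_pow_eq_monomial, ← C_mul_X_pow_eq_monomial,
        smul_eq_C_mul, smul_eq_C_mul]
      rcases m with _ | m
      · simp
        ring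
      · simp only [C_mul, C_add, C_sub, C_1, Nat.add_sub_cancel]
        ring
    rw [key, map_sub, map_smul, map_smul, sphereCoordIntegral_X_pow, sphereCoordIntegral_X_pow,
      smul_eq_mul, smul_eq_mul]
    rcases m.even_or_odd' with ⟨q, rfl | rfl⟩
    · rw [sphereUniform_odd_moment i (m := 2 * q + 1) ⟨q, rfl⟩]
      rcases q with _ | q
      · simp
      · rw [sphereUniform_odd_moment i (m := 2 * (q + 1) - 1) ⟨q, by omega⟩]
        ring
    · have := sphereUniform_moment_add_two i q
      rw [Nat.add_sub_cancel, show 2 * q + 1 + 1 = 2 * (q + 1) by ring]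
      push_cast
      linear_combination -a * this

end SphereIntegral

section ZonalSums

open Polynomial

variable {ι : Type*} [Fintype ι]

theorem integrable_sq_sum_eval [Nonempty ι] (u : ι → ℝ[X]) :
    Integrable (fun s : Metric.sphere (0 : EuclideanSpace ℝ ι) 1 =>
      (∑ i, (u i).eval (s.1 i)) ^ 2) (sphereUniform ι) :=
  integrable_sphereUniform (g := fun x : EuclideanSpace ℝ ι => (∑ i, (u i).eval (x i)) ^ 2)
    (by fun_prop)

theorem integral_sq_sum_eval_of_odd [Nonempty ι] (u : ι → ℝ[X])
    (hu : ∀ i, (u i).comp (-X) = -u i) :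
    ∫ s, (∑ i, (u i).eval (s.1 i)) ^ 2 ∂sphereUniform ι =
      ∑ i, sphereCoordIntegral i (u i ^ 2) := by
  classical
  have hodd : ∀ i t, (u i).eval (-t) = -(u i).eval t := fun i t => by
    rw [← eval_neg, ← hu, eval_comp, eval_neg, eval_X]
  simp only [sq, Finset.sum_mul_sum]
  have hint : ∀ i j : ι, Integrable
      (fun s : Metric.sphere (0 : EuclideanSpace ℝ ι) 1 =>
        (u i).eval (s.1 i) * (u j).eval (s.1 j)) (sphereUniform ι) := fun i j =>
    integrable_sphereUniform (g := fun x => (u i).eval (x i) * (u j).eval (x j)) (by fun_prop)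
  rw [integral_finsetSum _ fun i _ => integrable_finsetSum _ fun j _ => hint i j]
  refine Finset.sum_congr rfl fun i _ => ?_
  rw [integral_finsetSum _ fun j _ => hint i j, Finset.sum_eq_single i]
  · simp [sphereCoordIntegral_apply]
  · intro j _ hj
    refine integral_sphereUniform_eq_zero_of_odd i
      (fun x => (u i).eval (x i) * (u j).eval (x j)) fun x => ?_
    rw [coordReflection_self, coordReflection_ne hj, hodd, neg_mul]
  · simp

theorem gradient_sum_eval (u : ι → ℝ[X]) (x : EuclideanSpace ℝ ι) :
    gradient (fun y : EuclideanSpace ℝ ι => ∑ i, (u i).eval (y i)) x =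
      WithLp.toLp 2 fun i => (derivative (u i)).eval (x i) := by
  refine HasGradientAt.gradient ?_
  rw [hasGradientAt_iff_hasFDerivAt]
  have h : HasFDerivAt (fun y : EuclideanSpace ℝ ι => ∑ i, (u i).eval (y i))
      (∑ i, (derivative (u i)).eval (x i) • (EuclideanSpace.proj i : EuclideanSpace ℝ ι →L[ℝ] ℝ))
      x :=
    HasFDerivAt.fun_sum fun i _ =>
      HasDerivAt.comp_hasFDerivAt (f := fun y : EuclideanSpace ℝ ι => y i) x
        ((u i).hasDerivAt (x i)) (EuclideanSpace.proj i : EuclideanSpace ℝ ι →L[ℝ] ℝ).hasFDerivAt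
  refine h.congr_fderiv ?_
  ext y
  simp [PiLp.inner_apply, mul_comm]

theorem norm_sphGrad_sq {h : EuclideanSpace ℝ ι → ℝ} {x : EuclideanSpace ℝ ι} (hx : ‖x‖ = 1) :
    ‖sphGrad h x‖ ^ 2 = ‖gradient h x‖ ^ 2 - ⟪gradient h x, x⟫ ^ 2 := by
  rw [sphGrad, norm_sub_sq_real, inner_smul_right, norm_smul, hx, mul_one, Real.norm_eq_abs,
    sq_abs]
  ring

theorem norm_sphGrad_sum_eval_sq (u : ι → ℝ[X]) {x : EuclideanSpace ℝ ι} (hx : ‖x‖ = 1) :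
    ‖sphGrad (fun y : EuclideanSpace ℝ ι => ∑ i, (u i).eval (y i)) x‖ ^ 2 =
      ∑ i, (derivative (u i) ^ 2).eval (x i) -
        (∑ i, (X * derivative (u i)).eval (x i)) ^ 2 := by
  rw [norm_sphGrad_sq hx, gradient_sum_eval, EuclideanSpace.norm_sq_eq]
  simp [PiLp.inner_apply]

theorem integral_norm_sphGrad_sq_of_odd [Nonempty ι] (u : ι → ℝ[X])
    (hu : ∀ i, (u i).comp (-X) = -u i) :
    ∫ s : Metric.sphere (0 : EuclideanSpace ℝ ι) 1,
        ‖sphGrad (fun y : EuclideanSpace ℝ ι => ∑ i, (u i).eval (y i)) s‖ ^ 2 ∂sphereUniform ι =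
      ∑ i, sphereCoordIntegral i ((1 - X ^ 2) * derivative (u i) ^ 2) := by
  have hodd : ∀ i, (X * derivative (u i)).comp (-X) = -(X * derivative (u i)) := fun i => by
    have := congrArg derivative (hu i)
    rw [derivative_comp, derivative_neg, derivative_neg, derivative_X, neg_mul, one_mul,
      neg_inj] at this
    rw [mul_comp, X_comp, this, neg_mul]
  have hint : ∀ i : ι, Integrable (fun s : Metric.sphere (0 : EuclideanSpace ℝ ι) 1 =>
      (derivative (u i) ^ 2).eval (s.1 i)) (sphereUniform ι) := fun i =>
    integrable_sphereUniform (g := fun x => (derivative (u i) ^ 2).eval (x i)) (by fun_prop)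
  simp only [norm_sphGrad_sum_eval_sq u (norm_eq_of_mem_sphere _)]
  rw [integral_sub (integrable_finsetSum _ fun i _ => hint i)
      (integrable_sq_sum_eval fun i => X * derivative (u i)),
    integral_finsetSum _ fun i _ => hint i, integral_sq_sum_eval_of_odd _ hodd,
    ← Finset.sum_sub_distrib]
  refine Finset.sum_congr rfl fun i _ => ?_
  rw [← sphereCoordIntegral_apply, ← map_sub]
  congr 1
  ring

end ZonalSums

theorem sq_Aconst (N ℓ : ℕ) :
    Aconst (N + 3) ℓ ^ 2 =
      (N.factorial * ℓ.factorial * (N + 1 + 2 * ℓ)) / ((N + ℓ).factorial * (N + 1)) := by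
  have e1 : N + 3 + ℓ - 3 = N + ℓ := by omega
  have e2 : ((N + 3 : ℕ) : ℝ) + 2 * ℓ - 2 = N + 1 + 2 * ℓ := by push_cast; ring
  have e3 : ((N + 3 : ℕ) : ℝ) - 2 = N + 1 := by push_cast; ring
  rw [Aconst, e1, e2, e3, Nat.add_sub_cancel, Real.sq_sqrt (by positivity)]

theorem stmt12 (ℓ : ℕ) (hodd : Odd ℓ) (hl : 1 ≤ ℓ) (n : ℕ) (hn : 3 ≤ n)
    (a : Fin n → ℝ) (ha : ∑ i, (a i) ^ 2 = 1)
    (p : EuclideanSpace ℝ (Fin n) → ℝ)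
    (hp : ∀ x, p x = ∑ i, a i * pli n ℓ i x) :
    (∫ x : Metric.sphere (0 : EuclideanSpace ℝ (Fin n)) 1,
        (p x) ^ 2 ∂(sphereUniform (Fin n)) = 1)
    ∧ (∫ x : Metric.sphere (0 : EuclideanSpace ℝ (Fin n)) 1,
        ‖sphGrad p x‖ ^ 2 ∂(sphereUniform (Fin n)) = ℓ * (n + ℓ - 2)) := by
  obtain ⟨N, rfl⟩ : ∃ N, n = N + 3 := ⟨n - 3, by omega⟩
  set k : ℝ := (((N + 3 : ℕ) : ℝ) - 2) / 2 with hk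
  have hk' : k = (N + 1) / 2 := by rw [hk]; push_cast; ring
  have hk0 : 0 < k := by rw [hk']; positivity
  have hcard : (Fintype.card (Fin (N + 3)) : ℝ) - 1 = 2 * k + 1 := by
    rw [Fintype.card_fin, hk]
    ring
  have hL : ∀ i : Fin (N + 3), ∀ f : Polynomial ℝ, sphereCoordIntegral i
      ((1 - Polynomial.X ^ 2) * Polynomial.derivative f -
        Polynomial.C (2 * k + 1) * (Polynomial.X * f)) = 0 := fun i f => by
    rw [← hcard]
    exact sphereCoordIntegral_by_parts i f
  have hnorm : ∀ i : Fin (N + 3),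
      Aconst (N + 3) ℓ ^ 2 * sphereCoordIntegral i (gegenbauerPoly k ℓ ^ 2) = 1 := fun i => by
    have h := gegenbauer_sq _ N (sphereCoordIntegral_one i) hk' (hL i) ℓ
    rw [hk'] at h ⊢
    rw [sq_Aconst, div_mul_eq_mul_div, div_eq_one_iff_eq (by positivity)]
    linear_combination 2 * h
  set u : Fin (N + 3) → Polynomial ℝ := fun i =>
    (a i * Aconst (N + 3) ℓ) • gegenbauerPoly k ℓ with hu
  have hodd_u : ∀ i, (u i).comp (-Polynomial.X) = -u i := fun i => by
    rw [hu, Polynomial.smul_comp, gegenbauerPoly_comp_neg_X k hodd, smul_neg]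
  obtain rfl : p = fun x => ∑ i, (u i).eval (x i) := by
    funext x
    rw [hp]
    refine Finset.sum_congr rfl fun i _ => ?_
    rw [hu, Polynomial.eval_smul, eval_gegenbauerPoly, pli, smul_eq_mul, mul_assoc]
  constructor
  · rw [integral_sq_sum_eval_of_odd u hodd_u, ← ha]
    refine Finset.sum_congr rfl fun i _ => ?_
    rw [hu, smul_pow, map_smul, smul_eq_mul]
    linear_combination a i ^ 2 * hnorm i
  · rw [integral_norm_sphGrad_sq_of_odd u hodd_u]
    have hterm : ∀ i, sphereCoordIntegral i
        ((1 - Polynomial.X ^ 2) * Polynomial.derivative (u i) ^ 2) =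
        a i ^ 2 * (ℓ * (ℓ + 2 * k)) := fun i => by
      rw [hu, Polynomial.derivative_smul, smul_pow, mul_smul_comm, map_smul, smul_eq_mul,
        gegenbauer_derivative_sq _ hk0 (hL i)]
      linear_combination a i ^ 2 * (ℓ * (ℓ + 2 * k)) * hnorm i
    rw [Finset.sum_congr rfl fun i _ => hterm i, ← Finset.sum_mul, ha, hk]
    ring

end
end

section
/- Fix an odd integer ℓ ≥ 1. There exist constants c > 0 and N such that for all n ≥ N, if X = (X_1,…,X_n) is a uniform random point of S^{n-1} and A = A_{n,ℓ}, then | A⁴ (n−2)⁴ · 𝔼[ (C^{n/2}_{ℓ−1}(X_1))² (C^{n/2}_{ℓ−1}(X_2))² ] − ℓ² n² | ≤ c·n. -/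
open MeasureTheory Real Finset

noncomputable section

/-- Integration in polar coordinates of a homogeneous function against `exp (-‖x‖ ^ 2)`. -/
theorem integral_homogeneous_mul_exp_neg_norm_sq {E : Type*} [NormedAddCommGroup E]
    [InnerProductSpace ℝ E] [FiniteDimensional ℝ E] [MeasurableSpace E] [BorelSpace E]
    [Nontrivial E] {P : E → ℝ} {d : ℕ} (hP : ∀ (r : ℝ) (x : E), P (r • x) = r ^ d * P x) :
    ∫ x, P x * exp (-‖x‖ ^ 2) =
      (∫ x, P (x : E) ∂(volume : Measure E).toSphere) *
        (Gamma ((Module.finrank ℝ E + d : ℝ) / 2) / 2) := by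
  have hdim : 0 < Module.finrank ℝ E := Module.finrank_pos
  set n := Module.finrank ℝ E with hn
  have hgamma : ∫ y in Set.Ioi (0 : ℝ), y ^ (n - 1) * (y ^ d * exp (-y ^ 2)) =
      Gamma ((n + d : ℝ) / 2) / 2 := by
    have h := integral_rpow_mul_exp_neg_rpow (p := 2) (q := ((n - 1 + d : ℕ) : ℝ)) (by norm_num)
      (by have : (0 : ℝ) ≤ ((n - 1 + d : ℕ) : ℝ) := Nat.cast_nonneg _
          linarith)
    have h2 : ((n - 1 + d : ℕ) : ℝ) + 1 = n + d := by
      rw [← Nat.cast_add_one, ← Nat.cast_add]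
      congr 1
      omega
    rw [h2] at h
    rw [show Gamma ((n + d : ℝ) / 2) / 2 = 1 / 2 * Gamma ((n + d : ℝ) / 2) by ring, ← h]
    refine setIntegral_congr_fun measurableSet_Ioi fun y _ ↦ ?_
    simp only [rpow_natCast, pow_add, rpow_ofNat]
    ring
  calc
    ∫ x, P x * exp (-‖x‖ ^ 2)
      = ∫ x : ({(0)}ᶜ : Set E), P x * exp (-‖(x : E)‖ ^ 2) ∂((volume : Measure E).comap (↑)) := by
      rw [integral_subtype_comap (measurableSet_singleton _).compl
        fun x : E ↦ P x * exp (-‖x‖ ^ 2), restrict_compl_singleton]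
    _ = ∫ z : Metric.sphere (0 : E) 1 × Set.Ioi (0 : ℝ),
          P z.1 * ((z.2 : ℝ) ^ d * exp (-(z.2 : ℝ) ^ 2))
          ∂(volume : Measure E).toSphere.prod (.volumeIoiPow (n - 1)) := by
      rw [← (volume : Measure E).measurePreserving_homeomorphUnitSphereProd.integral_comp
        (Homeomorph.measurableEmbedding _)]
      refine integral_congr_ae (.of_forall fun x ↦ ?_)
      have hx : ‖(x : E)‖ ≠ 0 := norm_ne_zero_iff.2 x.2
      simp only [homeomorphUnitSphereProd_apply_fst_coe, homeomorphUnitSphereProd_apply_snd_coe]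
      rw [hP, inv_pow]
      field_simp
    _ = (∫ x, P (x : E) ∂(volume : Measure E).toSphere) *
          ∫ y : Set.Ioi (0 : ℝ), (y : ℝ) ^ d * exp (-(y : ℝ) ^ 2) ∂.volumeIoiPow (n - 1) :=
      integral_prod_mul (fun x : Metric.sphere (0 : E) 1 ↦ P x)
        fun y : Set.Ioi (0 : ℝ) ↦ (y : ℝ) ^ d * exp (-(y : ℝ) ^ 2)
    _ = _ := by
      rw [← hgamma]
      congr 1
      simp only [Measure.volumeIoiPow, ENNReal.ofReal]
      rw [integral_withDensity_eq_integral_smul,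
        integral_subtype_comap measurableSet_Ioi
          fun a ↦ Real.toNNReal (a ^ (n - 1)) • (a ^ d * exp (-a ^ 2)),
        setIntegral_congr_fun measurableSet_Ioi fun x hx ↦ ?_]
      · rw [NNReal.smul_def, Real.coe_toNNReal _ (pow_nonneg (le_of_lt hx) _), smul_eq_mul]
      · exact (measurable_subtype_coe.pow_const _).real_toNNReal

theorem integral_pow_two_mul_mul_exp_neg_sq (a : ℕ) :
    ∫ x : ℝ, x ^ (2 * a) * exp (-x ^ 2) = Gamma (a + 1 / 2) := by
  have h := integral_rpow_mul_exp_neg_rpow (p := 2) (q := ((2 * a : ℕ) : ℝ)) (by norm_num)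
    (by have : (0 : ℝ) ≤ ((2 * a : ℕ) : ℝ) := Nat.cast_nonneg _
        linarith)
  have habs : ∫ x : ℝ, x ^ (2 * a) * exp (-x ^ 2) =
      ∫ x : ℝ, (fun y ↦ y ^ (2 * a) * exp (-y ^ 2)) |x| := by
    simp only [sq_abs, (even_two_mul a).pow_abs]
  rw [habs, integral_comp_abs (f := fun y ↦ y ^ (2 * a) * exp (-y ^ 2))]
  simp only [rpow_natCast, rpow_ofNat] at h
  rw [h, show (((2 * a : ℕ) : ℝ) + 1) / 2 = a + 1 / 2 by push_cast; ring]
  ring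

theorem integral_prod_pow_mul_exp_neg_norm_sq {ι : Type*} [Fintype ι] (e : ι → ℕ) :
    ∫ x : EuclideanSpace ℝ ι, (∏ i, x i ^ (2 * e i)) * exp (-‖x‖ ^ 2) =
      ∏ i, Gamma (e i + 1 / 2) := by
  rw [← (PiLp.volume_preserving_toLp ι).integral_comp
    (MeasurableEquiv.toLp 2 (ι → ℝ)).measurableEmbedding]
  simp only [EuclideanSpace.norm_sq_eq, norm_eq_abs, sq_abs, ← Finset.sum_neg_distrib, exp_sum,
    ← Finset.prod_mul_distrib]
  rw [integral_fintype_prod_volume_eq_prod fun i (x : ℝ) ↦ x ^ (2 * e i) * exp (-x ^ 2)]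
  simp only [integral_pow_two_mul_mul_exp_neg_sq]

/-- The even moments of the uniform distribution on the sphere. -/
theorem integral_prod_pow_sphereUniform {ι : Type*} [Fintype ι] [Nonempty ι] (e : ι → ℕ) :
    ∫ x, ∏ i, (x : EuclideanSpace ℝ ι) i ^ (2 * e i) ∂sphereUniform ι =
      (∏ i, Gamma (e i + 1 / 2) / √π) *
        (Gamma (Fintype.card ι / 2) / Gamma (Fintype.card ι / 2 + ∑ i, e i)) := by
  have hmom (e : ι → ℕ) :
      (∫ x, ∏ i, (x : EuclideanSpace ℝ ι) i ^ (2 * e i)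
          ∂(volume : Measure (EuclideanSpace ℝ ι)).toSphere) *
        (Gamma (Fintype.card ι / 2 + ∑ i, e i) / 2) = ∏ i, Gamma (e i + 1 / 2) := by
    rw [← integral_prod_pow_mul_exp_neg_norm_sq,
      integral_homogeneous_mul_exp_neg_norm_sq (d := 2 * ∑ i, e i), finrank_euclideanSpace]
    · push_cast
      congr 3
      ring
    · intro r x
      simp only [PiLp.smul_apply, smul_eq_mul, mul_pow, Finset.prod_mul_distrib,
        Finset.prod_pow_eq_pow_sum, Finset.mul_sum]
  have hcard : (0 : ℝ) < Fintype.card ι := Nat.cast_pos.2 Fintype.card_pos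
  have hG0 : 0 < Gamma (Fintype.card ι / 2 : ℝ) := Gamma_pos_of_pos (by positivity)
  have hG : 0 < Gamma (Fintype.card ι / 2 + ∑ i, e i : ℝ) :=
    Gamma_pos_of_pos (by positivity)
  have h0 := hmom 0
  simp only [Pi.zero_apply, mul_zero, pow_zero, Finset.prod_const_one, integral_const,
    smul_eq_mul, mul_one, Finset.sum_const_zero, Nat.cast_zero, add_zero, zero_add,
    Gamma_one_half_eq, Finset.prod_const, Finset.card_univ] at h0
  have hpi : 0 < √π ^ Fintype.card ι := by positivity
  rw [sphereUniform, integral_smul_measure, ENNReal.toReal_inv, smul_eq_mul,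
    Finset.prod_div_distrib, Finset.prod_const, Finset.card_univ, ← hmom e, ← h0]
  change (Measure.real _ _)⁻¹ * _ = _
  have hS : (volume : Measure (EuclideanSpace ℝ ι)).toSphere.real Set.univ ≠ 0 := by
    rintro h
    rw [h, zero_mul] at h0
    exact hpi.ne h0
  field_simp

/-- `f n = c + O(1 / n)`. -/
def HasRate (f : ℕ → ℝ) (c : ℝ) : Prop :=
  (fun n ↦ f n - c) =O[Filter.atTop] fun n : ℕ ↦ (n : ℝ)⁻¹

namespace HasRate

variable {f g : ℕ → ℝ} {a b : ℝ}

theorem const (a : ℝ) : HasRate (fun _ ↦ a) a := by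
  simpa [HasRate] using Asymptotics.isBigO_zero _ _

theorem tendsto (hf : HasRate f a) : Filter.Tendsto f Filter.atTop (nhds a) :=
  tendsto_sub_nhds_zero_iff.1 (hf.trans_tendsto tendsto_inv_atTop_nhds_zero_nat)

theorem congr' (hf : HasRate f a) (h : f =ᶠ[Filter.atTop] g) : HasRate g a :=
  Asymptotics.IsBigO.congr' hf (h.mono fun n hn ↦ by simp [hn]) .rfl

theorem add (hf : HasRate f a) (hg : HasRate g b) : HasRate (fun n ↦ f n + g n) (a + b) :=
  (Asymptotics.IsBigO.add hf hg).congr_left fun n ↦ by ring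

theorem mul (hf : HasRate f a) (hg : HasRate g b) : HasRate (fun n ↦ f n * g n) (a * b) := by
  have h1 := (Asymptotics.IsBigO.mul hf (hg.tendsto.isBigO_one ℝ)).congr_right
    fun n : ℕ ↦ mul_one (n : ℝ)⁻¹
  have h2 : (fun n ↦ a * (g n - b)) =O[Filter.atTop] fun n : ℕ ↦ (n : ℝ)⁻¹ :=
    Asymptotics.IsBigO.const_mul_left hg a
  exact (h1.add h2).congr_left fun n ↦ by ring

theorem inv (hf : HasRate f a) (ha : a ≠ 0) : HasRate (fun n ↦ (f n)⁻¹) a⁻¹ := by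
  have h1 := (Asymptotics.IsBigO.mul hf (((hf.tendsto.inv₀ ha).const_mul (-a⁻¹)).isBigO_one ℝ))
  refine (h1.congr_right fun n : ℕ ↦ mul_one (n : ℝ)⁻¹).congr' ?_ .rfl
  filter_upwards [hf.tendsto.eventually_ne ha] with n hn
  field_simp
  ring

theorem pow (hf : HasRate f a) (k : ℕ) : HasRate (fun n ↦ f n ^ k) (a ^ k) := by
  induction k with
  | zero => simpa using const 1
  | succ k ih => simpa only [pow_succ] using ih.mul hf

theorem sum {ι : Type*} (s : Finset ι) {f : ι → ℕ → ℝ} {a : ι → ℝ}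
    (h : ∀ i ∈ s, HasRate (f i) (a i)) :
    HasRate (fun n ↦ ∑ i ∈ s, f i n) (∑ i ∈ s, a i) := by
  simp only [HasRate, ← Finset.sum_sub_distrib]
  exact (Asymptotics.IsBigO.sum h).congr_left fun n ↦ Finset.sum_apply n s _

theorem one_add_div (b : ℝ) : HasRate (fun n ↦ 1 + b / n) 1 := by
  simpa [HasRate, div_eq_mul_inv] using
    (Asymptotics.isBigO_refl (fun n : ℕ ↦ (n : ℝ)⁻¹) _).const_mul_left b

end HasRate

/-- `Γ(n / 2 + s) / Γ(n / 2)`, divided by its leading order in `n`. -/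
def gammaRatio (s n : ℕ) : ℝ :=
  Gamma (n / 2 + s) / (Gamma (n / 2) * (n / 2) ^ s)

theorem hasRate_gammaRatio (s : ℕ) : HasRate (gammaRatio s) 1 := by
  induction s with
  | zero =>
    refine (HasRate.const 1).congr' ?_
    filter_upwards [Filter.eventually_gt_atTop 0] with n hn
    have : Gamma (n / 2 : ℝ) ≠ 0 := (Gamma_pos_of_pos (by positivity)).ne'
    simp [gammaRatio, this]
  | succ s ih =>
    rw [← one_mul (1 : ℝ)]
    refine (ih.mul (HasRate.one_add_div (2 * s))).congr' ?_
    filter_upwards [Filter.eventually_gt_atTop 0] with n hn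
    have : Gamma (n / 2 : ℝ) ≠ 0 := (Gamma_pos_of_pos (by positivity)).ne'
    have hpos : (0 : ℝ) < n := Nat.cast_pos.2 hn
    rw [gammaRatio, gammaRatio, Nat.cast_add_one, ← add_assoc, Gamma_add_one (by positivity),
      pow_succ]
    field_simp

theorem hasRate_factorial_ratio (s : ℕ) :
    HasRate (fun n ↦ (n + s - 3).factorial / ((n - 3).factorial * (n : ℝ) ^ s)) 1 := by
  induction s with
  | zero =>
    refine (HasRate.const 1).congr' (.of_forall fun n ↦ ?_)
    simp [Nat.factorial_ne_zero]
  | succ s ih =>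
    rw [← one_mul (1 : ℝ)]
    refine (ih.mul (HasRate.one_add_div (s - 2))).congr' ?_
    filter_upwards [Filter.eventually_ge_atTop 3] with n hn
    have hpos : (0 : ℝ) < n := Nat.cast_pos.2 (by omega)
    have hf : ((n - 3).factorial : ℝ) ≠ 0 := by positivity
    obtain ⟨k, rfl⟩ := Nat.exists_eq_add_of_le hn
    rw [show 3 + k + (s + 1) - 3 = k + s + 1 by omega, show 3 + k + s - 3 = k + s by omega,
      Nat.factorial_succ]
    push_cast at *
    field_simp
    ring

open Polynomial in
/-- The linear functional sending `X ^ d` to the `d`-th moment of a standard Gaussian. -/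
def gaussianMoment : ℝ[X] →ₗ[ℝ] ℝ :=
  Polynomial.lsum fun d ↦
    (if Even d then ((d - 1).doubleFactorial : ℝ) else 0) • LinearMap.id

namespace gaussianMoment

open Polynomial

theorem monomial (d : ℕ) (c : ℝ) :
    gaussianMoment (monomial d c) = (if Even d then ((d - 1).doubleFactorial : ℝ) else 0) * c := by
  rw [gaussianMoment, lsum_apply, sum_monomial_index _ _ (by simp)]
  split_ifs <;> simp

theorem X_mul (p : ℝ[X]) : gaussianMoment (X * p) = gaussianMoment (derivative p) := by
  induction p using Polynomial.induction_on' with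
  | add p q hp hq => simp only [mul_add, map_add, hp, hq]
  | monomial d c =>
    rw [X_mul_monomial, derivative_monomial, monomial, monomial]
    rcases d with _ | d
    · simp
    · have hpar : Even (d + 1 + 1) ↔ Even d := by simp [Nat.even_add_one]
      simp only [hpar, Nat.add_sub_cancel, Nat.doubleFactorial_add_one]
      split_ifs
      · push_cast
        ring
      · simp

theorem hermite_mul (m : ℕ) (q : ℝ[X]) :
    gaussianMoment ((hermite m).map (Int.castRingHom ℝ) * q) =
      gaussianMoment (derivative^[m] q) := by
  induction m generalizing q with
  | zero => simp
  | succ m ih =>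
    rw [Function.iterate_succ_apply, ← ih, hermite_succ, Polynomial.map_sub, Polynomial.map_mul,
      map_X, sub_mul, map_sub, mul_assoc, X_mul, derivative_mul, map_add, ← derivative_map,
      add_sub_cancel_left]

theorem hermite_sq (m : ℕ) :
    gaussianMoment ((hermite m).map (Int.castRingHom ℝ) ^ 2) = m.factorial := by
  have hd : ((hermite m).map (Int.castRingHom ℝ)).natDegree = m := by
    rw [(hermite_monic m).natDegree_map, natDegree_hermite]
  rw [sq, hermite_mul, eq_C_of_natDegree_le_zero
    ((natDegree_iterate_derivative _ m).trans (by simp [hd])), coeff_iterate_derivative,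
    ← monomial_zero_left, monomial]
  simp [Nat.descFactorial_self]

end gaussianMoment

/-- The coefficient of `X ^ (m - 2 * j)` in the Hermite polynomial `hermite m / m!`. -/
def hermiteCoeff (m j : ℕ) : ℝ :=
  (-1 : ℝ) ^ j / (2 ^ j * j.factorial * (m - 2 * j).factorial)

open Polynomial in
theorem hermite_eq_sum (m : ℕ) :
    (hermite m).map (Int.castRingHom ℝ) = (m.factorial : ℝ) •
      ∑ j ∈ Finset.range (m / 2 + 1), Polynomial.monomial (m - 2 * j) (hermiteCoeff m j) := by
  ext k
  rw [coeff_map, coeff_smul, finsetSum_coeff]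
  simp only [coeff_monomial, eq_intCast]
  rcases lt_or_ge m k with hk | hk
  · rw [coeff_hermite_of_lt hk, Finset.sum_eq_zero]
    · simp
    · intro j _
      rw [if_neg (by omega)]
  rcases Nat.even_or_odd (m + k) with he | ho
  · obtain ⟨i, rfl⟩ : ∃ i, m = 2 * i + k := ⟨(m - k) / 2, by grind⟩
    rw [coeff_hermite_explicit, Finset.sum_eq_single_of_mem i (by simp; omega)]
    · have hdf : ((2 * i - 1).doubleFactorial : ℝ) * (2 ^ i * i.factorial) =
          (2 * i).factorial := by
        rcases i with _ | i
        · simp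
        · have hfac := Nat.factorial_eq_mul_doubleFactorial (2 * i + 1)
          rw [show 2 * i + 1 + 1 = 2 * (i + 1) by ring, Nat.doubleFactorial_two_mul] at hfac
          rw [hfac, show 2 * (i + 1) - 1 = 2 * i + 1 by omega]
          push_cast
          ring
      have hch : ((2 * i + k).choose k : ℝ) * k.factorial * (2 * i).factorial =
          (2 * i + k).factorial := by
        have := Nat.choose_mul_factorial_mul_factorial (Nat.le_add_left k (2 * i))
        rw [Nat.add_sub_cancel] at this
        exact_mod_cast this
      rw [if_pos (by omega), ← hch, ← hdf]
      push_cast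
      rw [hermiteCoeff, Nat.add_sub_cancel_left, smul_eq_mul]
      field_simp
    · intro j hj hne
      rw [if_neg]
      simp at hj
      omega
  · rw [coeff_hermite_of_odd_add ho, Finset.sum_eq_zero]
    · simp
    · intro j hj
      rw [if_neg]
      simp at hj
      grind

/-- The normalized Hermite polynomials `hermite m / √m!` have unit norm, in terms of coefficients. -/
theorem sum_sum_hermite_coeff (m : ℕ) :
    ∑ i ∈ Finset.range (m / 2 + 1), ∑ j ∈ Finset.range (m / 2 + 1),
      hermiteCoeff m i * hermiteCoeff m j *
        (2 * (m - i - j) - 1).doubleFactorial = 1 / m.factorial := by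
  have h := gaussianMoment.hermite_sq m
  rw [hermite_eq_sum, smul_pow, map_smul, sq (∑ _ ∈ _, _), Finset.sum_mul_sum] at h
  simp only [Polynomial.monomial_mul_monomial, map_sum, gaussianMoment.monomial] at h
  have hm : (m.factorial : ℝ) ≠ 0 := by positivity
  rw [eq_div_iff hm, ← mul_left_inj' hm]
  rw [smul_eq_mul] at h
  refine Eq.trans ?_ (h.trans (one_mul _).symm)
  rw [mul_assoc, ← sq, mul_comm]
  congr 1
  refine Finset.sum_congr rfl fun i hi ↦ Finset.sum_congr rfl fun j hj ↦ ?_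
  simp only [Finset.mem_range] at hi hj
  rw [show m - 2 * i + (m - 2 * j) = 2 * (m - i - j) by omega, if_pos (even_two_mul _)]
  ring

theorem gammaRatio_pos (s : ℕ) {n : ℕ} (hn : 0 < n) : 0 < gammaRatio s n := by
  have hpos : (0 : ℝ) < n := Nat.cast_pos.2 hn
  have h1 : 0 < Gamma (n / 2 : ℝ) := Gamma_pos_of_pos (by positivity)
  have h2 : 0 < Gamma (n / 2 + s : ℝ) := Gamma_pos_of_pos (by positivity)
  unfold gammaRatio
  positivity

theorem gegenbauer_eq_sum_hermiteCoeff (m : ℕ) {n : ℕ} (hn : 0 < n) (t : ℝ) :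
    gegenbauer (n / 2) m t = ∑ j ∈ Finset.range (m / 2 + 1),
      hermiteCoeff m j * gammaRatio (m - j) n * n ^ (m - j) * t ^ (m - 2 * j) := by
  rw [gegenbauer, Finset.mul_sum]
  refine Finset.sum_congr rfl fun j hj ↦ ?_
  rw [Finset.mem_range] at hj
  have hjm : j ≤ m := by omega
  have hpos : (0 : ℝ) < n := Nat.cast_pos.2 hn
  have hG : Gamma (n / 2 : ℝ) ≠ 0 := (Gamma_pos_of_pos (by positivity)).ne'
  have h2 : (2 : ℝ) ^ m = 2 ^ (m - j) * 2 ^ j := by rw [← pow_add, Nat.sub_add_cancel hjm]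
  rw [hermiteCoeff, gammaRatio, Nat.cast_sub hjm, ← add_sub_assoc, h2, div_pow, pow_mul',
    sq ((2 : ℝ) ^ j)]
  field_simp

theorem gegenbauer_sq_eq_sum (m : ℕ) {n : ℕ} (hn : 0 < n) (t : ℝ) :
    gegenbauer (n / 2) m t ^ 2 =
      ∑ p ∈ Finset.range (m / 2 + 1) ×ˢ Finset.range (m / 2 + 1),
        hermiteCoeff m p.1 * hermiteCoeff m p.2 *
          (gammaRatio (m - p.1) n * gammaRatio (m - p.2) n * n ^ (m - p.1) * n ^ (m - p.2)) *
          t ^ (2 * (m - p.1 - p.2)) := by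
  rw [gegenbauer_eq_sum_hermiteCoeff m hn, sq, Finset.sum_mul_sum, ← Finset.sum_product']
  refine Finset.sum_congr rfl fun p hp ↦ ?_
  simp only [Finset.mem_product, Finset.mem_range] at hp
  rw [show 2 * (m - p.1 - p.2) = (m - 2 * p.1) + (m - 2 * p.2) by omega, pow_add]
  ring

theorem integral_pow_mul_pow_sphereUniform {n : ℕ} {i j : Fin n} (hij : i ≠ j) (a b : ℕ) :
    ∫ x, (x : EuclideanSpace ℝ (Fin n)) i ^ (2 * a) * (x : EuclideanSpace ℝ (Fin n)) j ^ (2 * b)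
        ∂sphereUniform (Fin n) =
      (2 * a - 1).doubleFactorial * (2 * b - 1).doubleFactorial /
        (gammaRatio (a + b) n * n ^ (a + b)) := by
  have : Nonempty (Fin n) := ⟨i⟩
  have hpos : (0 : ℝ) < n := Nat.cast_pos.2 i.pos
  let e : Fin n → ℕ := fun k ↦ if k = i then a else if k = j then b else 0
  have hei : e i = a := if_pos rfl
  have hej : e j = b := by simp [e, hij.symm]
  have he {k : Fin n} (hk : k ≠ i ∧ k ≠ j) : e k = 0 := by simp [e, hk.1, hk.2]
  have h := integral_prod_pow_sphereUniform e
  have hsum : ∑ k, e k = a + b := by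
    rw [Fintype.sum_eq_add i j hij fun k ↦ he, hei, hej]
  have hprod (x : EuclideanSpace ℝ (Fin n)) :
      ∏ k, x k ^ (2 * e k) = x i ^ (2 * a) * x j ^ (2 * b) := by
    rw [Fintype.prod_eq_mul i j hij fun k hk ↦ by simp [he hk], hei, hej]
  have hpi : √π ≠ 0 := by positivity
  simp only [hprod] at h
  rw [h, Fintype.prod_eq_mul i j hij fun k hk ↦ by
    rw [he hk, Nat.cast_zero, zero_add, Gamma_one_half_eq, div_self hpi], hei, hej, hsum,
    Fintype.card_fin, Gamma_nat_add_half, Gamma_nat_add_half, gammaRatio, div_pow, pow_add 2 a b]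
  have hG : Gamma (n / 2 : ℝ) ≠ 0 := (Gamma_pos_of_pos (by positivity)).ne'
  have hG' : Gamma (n / 2 + (a + b : ℕ) : ℝ) ≠ 0 := (Gamma_pos_of_pos (by positivity)).ne'
  field_simp

theorem Continuous.integrable_sphereUniform {ι : Type*} [Fintype ι] [Nonempty ι]
    {f : Metric.sphere (0 : EuclideanSpace ℝ ι) 1 → ℝ} (hf : Continuous f) :
    Integrable f (sphereUniform ι) := by
  refine Integrable.smul_measure ?_ (ENNReal.inv_ne_top.2 ?_)
  · exact hf.integrable_of_hasCompactSupport (HasCompactSupport.of_compactSpace f)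
  · rw [Ne, Measure.measure_univ_eq_zero]
    exact Measure.toSphere_ne_zero _

/-- The expectation of `(C^{n/2}_m(X_i))² (C^{n/2}_m(X_j))²`, with the powers of `n` factored out. -/
theorem integral_gegenbauer_sq_mul_gegenbauer_sq (m : ℕ) {n : ℕ} {i j : Fin n} (hij : i ≠ j) :
    ∫ x, gegenbauer (n / 2) m ((x : EuclideanSpace ℝ (Fin n)) i) ^ 2 *
        gegenbauer (n / 2) m ((x : EuclideanSpace ℝ (Fin n)) j) ^ 2 ∂sphereUniform (Fin n) =
      n ^ (2 * m) * ∑ p ∈ Finset.range (m / 2 + 1) ×ˢ Finset.range (m / 2 + 1),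
        ∑ q ∈ Finset.range (m / 2 + 1) ×ˢ Finset.range (m / 2 + 1),
          hermiteCoeff m p.1 * hermiteCoeff m p.2 * (2 * (m - p.1 - p.2) - 1).doubleFactorial *
          (hermiteCoeff m q.1 * hermiteCoeff m q.2 * (2 * (m - q.1 - q.2) - 1).doubleFactorial) *
          (gammaRatio (m - p.1) n * gammaRatio (m - p.2) n *
            (gammaRatio (m - q.1) n * gammaRatio (m - q.2) n) *
            (gammaRatio (m - p.1 - p.2 + (m - q.1 - q.2)) n)⁻¹) := by
  have : Nonempty (Fin n) := ⟨i⟩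
  simp only [gegenbauer_sq_eq_sum m i.pos, Finset.sum_mul_sum]
  rw [integral_finsetSum _ fun p _ ↦ Continuous.integrable_sphereUniform (by fun_prop),
    Finset.mul_sum]
  refine Finset.sum_congr rfl fun p hp ↦ ?_
  rw [integral_finsetSum _ fun p _ ↦ Continuous.integrable_sphereUniform (by fun_prop),
    Finset.mul_sum]
  refine Finset.sum_congr rfl fun q hq ↦ ?_
  simp only [Finset.mem_product, Finset.mem_range] at hp hq
  simp only [mul_mul_mul_comm _ (_ ^ (2 * (m - p.1 - p.2))), integral_const_mul,
    integral_pow_mul_pow_sphereUniform hij]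
  have hpos : (0 : ℝ) < n := Nat.cast_pos.2 i.pos
  have hR := (gammaRatio_pos (m - p.1 - p.2 + (m - q.1 - q.2)) i.pos).ne'
  have hpow : (n : ℝ) ^ (m - p.1) * n ^ (m - p.2) * (n ^ (m - q.1) * n ^ (m - q.2)) =
      n ^ (2 * m) * n ^ (m - p.1 - p.2 + (m - q.1 - q.2)) := by
    simp only [← pow_add]
    congr 1
    omega
  rw [mul_div_assoc', div_eq_iff (by positivity)]
  field_simp
  linear_combination (hermiteCoeff m p.1 * hermiteCoeff m p.2 * hermiteCoeff m q.1 *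
    hermiteCoeff m q.2 * gammaRatio (m - p.1) n * gammaRatio (m - p.2) n *
    gammaRatio (m - q.1) n * gammaRatio (m - q.2) n) * hpow

theorem Aconst_pow_four_mul (ℓ : ℕ) {n : ℕ} (hn : 3 ≤ n) :
    Aconst n ℓ ^ 4 * ((n : ℝ) - 2) ^ 4 * n ^ (2 * ℓ) =
      n ^ 4 * (ℓ.factorial * ((1 + (2 * ℓ - 2) / n) * (1 + -2 / n)) *
        ((n + ℓ - 3).factorial / ((n - 3).factorial * (n : ℝ) ^ ℓ))⁻¹) ^ 2 := by
  have hn' : (3 : ℝ) ≤ n := by exact_mod_cast hn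
  have hn2 : (0 : ℝ) < n - 2 := by linarith
  have hℓ : (0 : ℝ) ≤ ℓ := Nat.cast_nonneg ℓ
  have hA : (0 : ℝ) < n + 2 * ℓ - 2 := by linarith
  rw [show 4 = 2 * 2 from rfl, pow_mul, Aconst, Real.sq_sqrt (by positivity)]
  have hn0 : (n : ℝ) ≠ 0 := by linarith
  have hn2' := hn2.ne'
  field_simp
  ring

theorem hasRate_gegenbauer_moment (ℓ : ℕ) (hl : 1 ≤ ℓ) {i j : ∀ n : ℕ, 3 ≤ n → Fin n}
    (hij : ∀ n hn, i n hn ≠ j n hn) :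
    ∃ F : ℕ → ℝ, HasRate F ((ℓ : ℝ) ^ 2) ∧ ∀ n (hn : 3 ≤ n),
      Aconst n ℓ ^ 4 * ((n : ℝ) - 2) ^ 4 *
        (∫ x, gegenbauer (n / 2) (ℓ - 1) ((x : EuclideanSpace ℝ (Fin n)) (i n hn)) ^ 2 *
          gegenbauer (n / 2) (ℓ - 1) ((x : EuclideanSpace ℝ (Fin n)) (j n hn)) ^ 2
          ∂sphereUniform (Fin n)) = F n * n ^ 2 := by
  obtain ⟨m, rfl⟩ := Nat.exists_eq_add_of_le' hl
  have hA := ((((HasRate.const ((m + 1).factorial : ℝ)).mul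
    ((HasRate.one_add_div (2 * (m + 1 : ℕ) - 2)).mul (HasRate.one_add_div (-2)))).mul
    ((hasRate_factorial_ratio (m + 1)).inv one_ne_zero)).pow 2)
  have hS := HasRate.sum (Finset.range (m / 2 + 1) ×ˢ Finset.range (m / 2 + 1)) fun p _ ↦
    HasRate.sum (Finset.range (m / 2 + 1) ×ˢ Finset.range (m / 2 + 1)) fun q _ ↦
      (HasRate.const (hermiteCoeff m p.1 * hermiteCoeff m p.2 *
        (2 * (m - p.1 - p.2) - 1).doubleFactorial * (hermiteCoeff m q.1 * hermiteCoeff m q.2 *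
          (2 * (m - q.1 - q.2) - 1).doubleFactorial))).mul
      ((((hasRate_gammaRatio (m - p.1)).mul (hasRate_gammaRatio (m - p.2))).mul
        ((hasRate_gammaRatio (m - q.1)).mul (hasRate_gammaRatio (m - q.2)))).mul
        ((hasRate_gammaRatio (m - p.1 - p.2 + (m - q.1 - q.2))).inv one_ne_zero))
  have hlim := hA.mul hS
  simp only [inv_one, mul_one] at hlim
  rw [← Finset.sum_mul_sum, Finset.sum_product, sum_sum_hermite_coeff] at hlim
  have hlead : ((m + 1).factorial : ℝ) ^ 2 * (1 / m.factorial * (1 / m.factorial)) =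
      ((m + 1 : ℕ) : ℝ) ^ 2 := by
    rw [Nat.factorial_succ]
    push_cast
    field_simp
  rw [hlead] at hlim
  refine ⟨_, hlim, fun n hn ↦ ?_⟩
  have hn0 : (n : ℝ) ≠ 0 := by positivity
  have h4 := Aconst_pow_four_mul (m + 1) hn
  rw [Nat.add_sub_cancel, integral_gegenbauer_sq_mul_gegenbauer_sq m (hij n hn)]
  rw [show 2 * (m + 1) = 2 * m + 2 by ring, pow_add, ← mul_assoc,
    show (n : ℝ) ^ 4 = n ^ 2 * n ^ 2 by ring] at h4
  have h4' := mul_right_cancel₀ (pow_ne_zero 2 hn0) (h4.trans (mul_right_comm _ _ _))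
  rw [← mul_assoc, h4']
  ring

theorem stmt13 (ℓ : ℕ) (hodd : Odd ℓ) (hl : 1 ≤ ℓ) :
    ∃ c > (0 : ℝ), ∃ N : ℕ, ∀ n : ℕ, ∀ hn3 : 3 ≤ n, ∀ hn : N ≤ n,
      |(Aconst n ℓ) ^ 4 * ((n : ℝ) - 2) ^ 4 *
          (∫ x : Metric.sphere (0 : EuclideanSpace ℝ (Fin n)) 1,
            (gegenbauer ((n : ℝ) / 2) (ℓ - 1) ((x : EuclideanSpace ℝ (Fin n)) (⟨0, by omega⟩ : Fin n))) ^ 2 *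
              (gegenbauer ((n : ℝ) / 2) (ℓ - 1) ((x : EuclideanSpace ℝ (Fin n)) (⟨1, by omega⟩ : Fin n))) ^ 2
            ∂(sphereUniform (Fin n)))
        - (ℓ : ℝ) ^ 2 * (n : ℝ) ^ 2| ≤ c * n := by
  obtain ⟨F, hF, hmain⟩ := hasRate_gegenbauer_moment ℓ hl
    (i := fun n hn ↦ ⟨0, by omega⟩) (j := fun n hn ↦ ⟨1, by omega⟩) (by simp)
  obtain ⟨c, hc, hbound⟩ := Asymptotics.IsBigO.exists_pos hF
  obtain ⟨N, hN⟩ := Filter.eventually_atTop.1 hbound.bound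
  refine ⟨c, hc, N, fun n hn3 hn ↦ ?_⟩
  have hpos : (0 : ℝ) < n := by positivity
  have h := hN n hn
  rw [norm_eq_abs, norm_of_nonneg (inv_nonneg.2 hpos.le)] at h
  rw [hmain n hn3, ← sub_mul, abs_mul, abs_of_pos (pow_pos hpos 2)]
  calc |F n - (ℓ : ℝ) ^ 2| * (n : ℝ) ^ 2 ≤ c * (n : ℝ)⁻¹ * (n : ℝ) ^ 2 := by gcongr
    _ = c * n := by field_simp

end
end

section
/- Fix an odd integer ℓ ≥ 1. There exist constants c > 0 and N such that for all n ≥ N, if X = (X_1,…,X_n) is a uniform random point of S^{n-1} and A = A_{n,ℓ}, then A⁴ (n−2)⁴ · 𝔼[ (C^{n/2}_{ℓ−1}(X_1))⁴ ] ≤ c·n². -/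
open MeasureTheory Real Finset

noncomputable section

open MeasureTheory.Measure Module Set in
/-- Polar coordinates for the product of a positively homogeneous function and a radial one. -/
theorem integral_homogeneous_mul_fun_norm {E : Type*} [NormedAddCommGroup E] [NormedSpace ℝ E]
    [Nontrivial E] [FiniteDimensional ℝ E] [MeasurableSpace E] [BorelSpace E]
    (μ : Measure E) [μ.IsAddHaarMeasure] {f : E → ℝ} {d : ℕ}
    (hf : ∀ r : ℝ, 0 < r → ∀ x, f (r • x) = r ^ d * f x) (g : ℝ → ℝ) :
    ∫ x, f x * g ‖x‖ ∂μ = (∫ x : Metric.sphere (0 : E) 1, f x ∂μ.toSphere) *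
      ∫ r in Ioi (0 : ℝ), r ^ (finrank ℝ E - 1) * (r ^ d * g r) :=
  calc
    ∫ x, f x * g ‖x‖ ∂μ = ∫ x : ({(0)}ᶜ : Set E), f x.1 * g ‖x.1‖ ∂(μ.comap (↑)) := by
      rw [integral_subtype_comap (measurableSet_singleton _).compl fun x ↦ f x * g ‖x‖,
        restrict_compl_singleton]
    _ = ∫ x, f x.1 * ((x.2 : ℝ) ^ d * g x.2)
          ∂μ.toSphere.prod (.volumeIoiPow (finrank ℝ E - 1)) := by
      rw [← μ.measurePreserving_homeomorphUnitSphereProd.integral_comp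
        (Homeomorph.measurableEmbedding _)]
      refine integral_congr_ae (.of_forall fun x ↦ ?_)
      have hx : 0 < ‖x.1‖ := norm_pos_iff.2 x.2
      simp only [homeomorphUnitSphereProd_apply_snd_coe, homeomorphUnitSphereProd_apply_fst_coe]
      rw [hf _ (inv_pos.2 hx), inv_pow]
      field_simp
    _ = (∫ x : Metric.sphere (0 : E) 1, f x ∂μ.toSphere) *
          ∫ r : Ioi (0 : ℝ), (r : ℝ) ^ d * g r ∂.volumeIoiPow (finrank ℝ E - 1) :=
      integral_prod_mul (fun x : Metric.sphere (0 : E) 1 ↦ f x)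
        (fun r : Ioi (0 : ℝ) ↦ (r : ℝ) ^ d * g r)
    _ = _ := by
      congr 1
      simp only [volumeIoiPow, ENNReal.ofReal]
      rw [integral_withDensity_eq_integral_smul,
        integral_subtype_comap measurableSet_Ioi
          fun a ↦ Real.toNNReal (a ^ (finrank ℝ E - 1)) • (a ^ d * g a),
        setIntegral_congr_fun measurableSet_Ioi fun x hx ↦ ?_]
      · simp only [NNReal.smul_def, Real.coe_toNNReal _ (pow_nonneg (le_of_lt hx) _), smul_eq_mul]
      · exact (measurable_subtype_coe.pow_const _).real_toNNReal

theorem integral_pow_mul_exp_neg_sq_Ioi (m : ℕ) :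
    ∫ r in Set.Ioi (0 : ℝ), r ^ m * exp (-r ^ 2) = Gamma ((m + 1) / 2) / 2 := by
  have h := integral_rpow_mul_exp_neg_rpow (p := 2) (q := m) two_pos
    (by linarith [m.cast_nonneg (α := ℝ)])
  simp only [rpow_natCast, rpow_ofNat] at h
  rw [h]; ring

theorem integral_coord_pow_mul_exp_neg_norm_sq_s14 {ι : Type*} [Fintype ι] (i : ι) (d : ℕ) :
    ∫ x : EuclideanSpace ℝ ι, x i ^ d * exp (-‖x‖ ^ 2) =
      (∫ t : ℝ, t ^ d * exp (-t ^ 2)) * √π ^ (Fintype.card ι - 1) := by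
  classical
  have h0 : ∫ t : ℝ, exp (-t ^ 2) = √π := by simpa using integral_gaussian 1
  rw [← (PiLp.volume_preserving_toLp ι).integral_comp (MeasurableEquiv.toLp 2 _).measurableEmbedding]
  calc
    _ = ∫ x : ι → ℝ, ∏ j, ((if j = i then x j ^ d else 1) * exp (-x j ^ 2)) := by
      refine integral_congr_ae (.of_forall fun x ↦ ?_)
      simp only [EuclideanSpace.norm_sq_eq, Finset.prod_mul_distrib, ← exp_sum]
      simp
    _ = ∏ j, ∫ t : ℝ, (if j = i then t ^ d else 1) * exp (-t ^ 2) :=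
      integral_fintype_prod_volume_eq_prod
        (fun j (t : ℝ) ↦ (if j = i then t ^ d else 1) * exp (-t ^ 2))
    _ = _ := by
      rw [← Finset.mul_prod_erase _ _ (mem_univ i), Finset.prod_congr rfl
        (g := fun _ ↦ √π) fun j hj ↦ by simp [Finset.ne_of_mem_erase hj, h0]]
      simp [Finset.card_erase_of_mem]

theorem Gamma_mul_pow_le_Gamma_add {x : ℝ} (hx : 0 < x) (p : ℕ) :
    Gamma x * x ^ p ≤ Gamma (x + p) := by
  induction p with
  | zero => simp
  | succ p ih =>
    have := Gamma_pos_of_pos hx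
    rw [Nat.cast_succ, ← add_assoc, Gamma_add_one (by positivity), pow_succ, ← mul_assoc, mul_comm]
    gcongr
    simp

theorem Gamma_add_le_Gamma_mul_pow {x : ℝ} (hx : 0 < x) (p : ℕ) :
    Gamma (x + p) ≤ Gamma x * (x + p) ^ p := by
  induction p with
  | zero => simp
  | succ p ih =>
    have := Gamma_pos_of_pos hx
    rw [Nat.cast_succ, ← add_assoc, Gamma_add_one (by positivity), mul_comm]
    calc _ ≤ Gamma x * (x + p) ^ p * (x + p) := by gcongr
      _ = Gamma x * (x + p) ^ (p + 1) := by ring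
      _ ≤ Gamma x * (x + p + 1) ^ (p + 1) :=
        mul_le_mul_of_nonneg_left
          (pow_le_pow_left₀ (by positivity) (le_add_of_nonneg_right zero_le_one) _) this.le

/-- The moments of a coordinate of a uniform point of the sphere, compared with Gaussian ones. -/
theorem card_pow_mul_integral_sphereUniform_le {ι : Type*} [Fintype ι] (i : ι) (p : ℕ) :
    (Fintype.card ι : ℝ) ^ p *
        ∫ x : Metric.sphere (0 : EuclideanSpace ℝ ι) 1, (x : EuclideanSpace ℝ ι) i ^ (2 * p)
          ∂sphereUniform ι ≤
      2 ^ p * ((∫ t : ℝ, t ^ (2 * p) * exp (-t ^ 2)) / √π) := by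
  have : Nonempty ι := ⟨i⟩
  set n := Fintype.card ι with hn
  have hn0 : 0 < n := Fintype.card_pos
  have hnR : (0 : ℝ) < n := by exact_mod_cast hn0
  have polar (d : ℕ) := (integral_homogeneous_mul_fun_norm
    (volume : Measure (EuclideanSpace ℝ ι)) (f := fun x ↦ x i ^ d) (d := d)
    (fun r _ x ↦ by simp [mul_pow]) (fun r ↦ exp (-r ^ 2))).symm.trans
    (integral_coord_pow_mul_exp_neg_norm_sq_s14 i d)
  simp only [← mul_assoc, ← pow_add, finrank_euclideanSpace, integral_pow_mul_exp_neg_sq_Ioi,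
    ← hn] at polar
  have e (d : ℕ) : ((n - 1 + d : ℕ) + 1 : ℝ) / 2 = n / 2 + d / 2 := by
    push_cast [Nat.cast_sub hn0]; ring
  simp only [e] at polar
  have h0 := polar 0
  have hp := polar (2 * p)
  have hg : ∫ t : ℝ, exp (-t ^ 2) = √π := by simpa using integral_gaussian 1
  simp only [pow_zero, one_mul, hg, integral_const, smul_eq_mul, mul_one, Nat.cast_zero, zero_div,
    add_zero] at h0
  rw [Nat.cast_mul, Nat.cast_ofNat, mul_div_cancel_left₀ _ two_ne_zero] at hp
  rw [sphereUniform, integral_smul_measure, ENNReal.toReal_inv, ← measureReal_def, smul_eq_mul]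
  set J := ∫ t : ℝ, t ^ (2 * p) * exp (-t ^ 2)
  set S := ∫ x : Metric.sphere (0 : EuclideanSpace ℝ ι) 1, (x : EuclideanSpace ℝ ι) i ^ (2 * p)
    ∂(volume : Measure (EuclideanSpace ℝ ι)).toSphere
  set V := (volume : Measure (EuclideanSpace ℝ ι)).toSphere.real Set.univ
  have hS : 0 ≤ S := integral_nonneg fun x ↦ (even_two_mul p).pow_nonneg _
  have hpi : 0 < √π := by positivity
  have hG : 0 < Gamma ((n : ℝ) / 2) := Gamma_pos_of_pos (by positivity)
  have hV : 0 < V := by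
    by_contra! h
    have : 0 < √π * √π ^ (n - 1) := by positivity
    nlinarith
  have key := Gamma_mul_pow_le_Gamma_add (x := (n : ℝ) / 2) (by positivity) p
  have h1 : S * (Gamma (n / 2) * (n / 2 : ℝ) ^ p) * √π ≤ J * (V * Gamma (n / 2)) := by
    calc _ ≤ S * Gamma (n / 2 + p) * √π := by gcongr
      _ = (S * (Gamma (n / 2 + p) / 2)) * (2 * √π) := by ring
      _ = J * (V * (Gamma (n / 2) / 2)) * 2 := by rw [hp, h0]; ring
      _ = _ := by ring
  rw [div_pow] at h1
  have h2 : S * (n : ℝ) ^ p * √π ≤ 2 ^ p * J * V := by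
    have : Gamma ((n : ℝ) / 2) * (S * ((n : ℝ) ^ p / 2 ^ p) * √π) ≤
      Gamma ((n : ℝ) / 2) * (J * V) := by linarith
    have h3 := le_of_mul_le_mul_left this hG
    calc _ = 2 ^ p * (S * ((n : ℝ) ^ p / 2 ^ p) * √π) := by field_simp
      _ ≤ 2 ^ p * (J * V) := by gcongr
      _ = _ := by ring
  rw [← mul_div_assoc, le_div_iff₀ hpi]
  calc _ = V⁻¹ * (S * (n : ℝ) ^ p * √π) := by ring
    _ ≤ V⁻¹ * (2 ^ p * J * V) := by gcongr
    _ = _ := by field_simp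

instance isProbabilityMeasure_sphereUniform {ι : Type*} [Fintype ι] [Nonempty ι] :
    IsProbabilityMeasure (sphereUniform ι) := by
  refine ⟨?_⟩
  rw [sphereUniform, Measure.smul_apply, smul_eq_mul]
  refine ENNReal.inv_mul_cancel ?_ (measure_ne_top _ _)
  exact Measure.measure_univ_ne_zero.2 (Measure.toSphere_ne_zero _)

theorem gegenbauer_pow_four_le {k : ℝ} (hk : 0 < k) (m : ℕ) (t : ℝ) :
    gegenbauer k m t ^ 4 ≤ ((m / 2 + 1 : ℕ) : ℝ) ^ 3 * ∑ j ∈ range (m / 2 + 1),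
      2 ^ (4 * m) * (k + m) ^ (4 * (m - j)) * t ^ (2 * (2 * (m - 2 * j))) := by
  have hG : 0 < Gamma k := Gamma_pos_of_pos hk
  rw [gegenbauer, Finset.mul_sum]
  have hsum (f : ℕ → ℝ) (s : Finset ℕ) : (∑ j ∈ s, f j) ^ 4 ≤ (#s : ℝ) ^ 3 * ∑ j ∈ s, f j ^ 4 := by
    calc (∑ j ∈ s, f j) ^ 4 = ((∑ j ∈ s, f j) ^ 2) ^ 2 := by ring
      _ ≤ (#s * ∑ j ∈ s, f j ^ 2) ^ 2 := by gcongr; exact sq_sum_le_card_mul_sum_sq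
      _ = #s ^ 2 * (∑ j ∈ s, f j ^ 2) ^ 2 := by ring
      _ ≤ #s ^ 2 * (#s * ∑ j ∈ s, (f j ^ 2) ^ 2) := by gcongr; exact sq_sum_le_card_mul_sum_sq
      _ = _ := by simp only [← pow_mul]; ring
  refine (hsum _ _).trans ?_
  rw [card_range]
  gcongr with j hj
  have hj' : j ≤ m := by have := mem_range.1 hj; omega
  set D : ℝ := 2 ^ (2 * j) * (Nat.factorial j) * (Nat.factorial (m - 2 * j)) with hD
  have hD1 : 1 ≤ D := by
    rw [hD]
    exact_mod_cast Nat.one_le_iff_ne_zero.2 (by positivity)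
  set G := Gamma (k + m - j) with hGd
  have e : k + m - j = k + (m - j : ℕ) := by rw [Nat.cast_sub hj']; ring
  have hG0 : 0 < G := by rw [hGd, e]; exact Gamma_pos_of_pos (by positivity)
  have hGle : G ≤ Gamma k * (k + m) ^ (m - j) := by
    rw [hGd, e]
    refine (Gamma_add_le_Gamma_mul_pow hk _).trans ?_
    gcongr
    omega
  calc _ = ((2 ^ m) ^ 4 * (G / Gamma k) ^ 4 * (t ^ (m - 2 * j)) ^ 4 * ((-1) ^ j) ^ 4) / D ^ 4 := by
        field_simp
    _ = ((2 ^ m) ^ 4 * (G / Gamma k) ^ 4 * (t ^ (m - 2 * j)) ^ 4) / D ^ 4 := by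
        rw [pow_right_comm (-1 : ℝ), Even.neg_one_pow (by decide), one_pow, mul_one]
    _ ≤ (2 ^ m) ^ 4 * (G / Gamma k) ^ 4 * (t ^ (m - 2 * j)) ^ 4 :=
        div_le_self (by positivity) (one_le_pow₀ hD1)
    _ ≤ (2 ^ m) ^ 4 * ((k + m) ^ (m - j)) ^ 4 * (t ^ (m - 2 * j)) ^ 4 := by
        gcongr
        exact (div_le_iff₀' hG).2 hGle
    _ = _ := by ring

theorem integral_gegenbauer_pow_four_le (m : ℕ) :
    ∃ K > (0 : ℝ), ∀ {ι : Type} [Fintype ι] (i : ι), 2 * m ≤ Fintype.card ι →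
      ∫ x : Metric.sphere (0 : EuclideanSpace ℝ ι) 1,
        gegenbauer ((Fintype.card ι : ℝ) / 2) m ((x : EuclideanSpace ℝ ι) i) ^ 4
          ∂sphereUniform ι ≤ K * (Fintype.card ι : ℝ) ^ (2 * m) := by
  set C : ℕ → ℝ := fun p ↦ 2 ^ p * ((∫ t : ℝ, t ^ (2 * p) * exp (-t ^ 2)) / √π)
  have hC (p : ℕ) : 0 ≤ C p := by
    have : 0 ≤ ∫ t : ℝ, t ^ (2 * p) * exp (-t ^ 2) :=
      integral_nonneg fun t ↦ mul_nonneg ((even_two_mul p).pow_nonneg _) (exp_nonneg _)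
    positivity
  refine ⟨((m / 2 + 1 : ℕ) : ℝ) ^ 3 *
    ∑ j ∈ range (m / 2 + 1), 2 ^ (4 * m) * C (2 * (m - 2 * j)) + 1, ?_, fun {ι} _ i hm ↦ ?_⟩
  · have := Finset.sum_nonneg fun j (_ : j ∈ range (m / 2 + 1)) ↦
      mul_nonneg (by positivity : (0 : ℝ) ≤ 2 ^ (4 * m)) (hC (2 * (m - 2 * j)))
    positivity
  have : Nonempty ι := ⟨i⟩
  set n := Fintype.card ι with hn
  have hnR : (0 : ℝ) < n := by exact_mod_cast Fintype.card_pos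
  have hint (p : ℕ) : Integrable (fun x : Metric.sphere (0 : EuclideanSpace ℝ ι) 1 ↦
      (x : EuclideanSpace ℝ ι) i ^ p) (sphereUniform ι) :=
    Continuous.integrable_of_hasCompactSupport (by fun_prop) (.of_compactSpace _)
  have hk : (n : ℝ) / 2 + m ≤ n := by
    have : (2 * m : ℝ) ≤ n := by exact_mod_cast hm
    linarith
  calc
    _ ≤ ∫ x : Metric.sphere (0 : EuclideanSpace ℝ ι) 1, ((m / 2 + 1 : ℕ) : ℝ) ^ 3 *
          ∑ j ∈ range (m / 2 + 1), 2 ^ (4 * m) * (n / 2 + m : ℝ) ^ (4 * (m - j)) *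
            (x : EuclideanSpace ℝ ι) i ^ (2 * (2 * (m - 2 * j))) ∂sphereUniform ι := by
      refine integral_mono_of_nonneg (.of_forall fun x ↦ by positivity) ?_
        (.of_forall fun x ↦ gegenbauer_pow_four_le (by positivity) _ _)
      exact (integrable_finsetSum _ fun j _ ↦ (hint _).const_mul _).const_mul _
    _ = ((m / 2 + 1 : ℕ) : ℝ) ^ 3 *
          ∑ j ∈ range (m / 2 + 1), 2 ^ (4 * m) * (n / 2 + m : ℝ) ^ (4 * (m - j)) *
            ∫ x : Metric.sphere (0 : EuclideanSpace ℝ ι) 1,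
              (x : EuclideanSpace ℝ ι) i ^ (2 * (2 * (m - 2 * j))) ∂sphereUniform ι := by
      rw [integral_const_mul, integral_finsetSum _ fun j _ ↦ (hint _).const_mul _]
      simp only [integral_const_mul]
    _ ≤ ((m / 2 + 1 : ℕ) : ℝ) ^ 3 *
          ∑ j ∈ range (m / 2 + 1), 2 ^ (4 * m) * C (2 * (m - 2 * j)) * (n : ℝ) ^ (2 * m) := by
      refine mul_le_mul_of_nonneg_left (Finset.sum_le_sum fun j hj ↦ ?_) (by positivity)
      have hj' : 4 * (m - j) = 2 * m + 2 * (m - 2 * j) := by have := mem_range.1 hj; omega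
      have h0 : 0 ≤ ∫ x : Metric.sphere (0 : EuclideanSpace ℝ ι) 1,
          (x : EuclideanSpace ℝ ι) i ^ (2 * (2 * (m - 2 * j))) ∂sphereUniform ι :=
        integral_nonneg fun x ↦ (even_two_mul _).pow_nonneg _
      have h1 := card_pow_mul_integral_sphereUniform_le i (2 * (m - 2 * j))
      calc _ ≤ 2 ^ (4 * m) * (n : ℝ) ^ (4 * (m - j)) *
            ∫ x : Metric.sphere (0 : EuclideanSpace ℝ ι) 1,
              (x : EuclideanSpace ℝ ι) i ^ (2 * (2 * (m - 2 * j))) ∂sphereUniform ι := by gcongr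
        _ = 2 ^ (4 * m) * ((n : ℝ) ^ (2 * (m - 2 * j)) *
            ∫ x : Metric.sphere (0 : EuclideanSpace ℝ ι) 1,
              (x : EuclideanSpace ℝ ι) i ^ (2 * (2 * (m - 2 * j))) ∂sphereUniform ι) *
              (n : ℝ) ^ (2 * m) := by rw [hj', pow_add]; ring
        _ ≤ _ := by
          rw [mul_assoc _ (C _), mul_assoc]
          gcongr
    _ ≤ _ := by
      rw [← Finset.sum_mul, ← mul_assoc]
      gcongr
      simp

theorem Aconst_sq_mul_pow_le {n ℓ : ℕ} (hn : 4 ≤ n) (hℓ : 2 * ℓ ≤ n) :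
    Aconst n ℓ ^ 2 * (n : ℝ) ^ ℓ ≤ 4 * 2 ^ ℓ * Nat.factorial ℓ := by
  obtain ⟨k, rfl⟩ : ∃ k, n = k + 3 := ⟨n - 3, by omega⟩
  have hk : (1 : ℝ) ≤ k := by exact_mod_cast (by omega : 1 ≤ k)
  have hℓ' : (2 * ℓ : ℝ) ≤ k + 3 := by exact_mod_cast hℓ
  have hfac : (Nat.factorial k : ℝ) * (k + 1) ^ ℓ ≤ Nat.factorial (k + ℓ) := by
    exact_mod_cast Nat.factorial_mul_pow_le_factorial
  have e1 : k + 3 - 3 = k := by omega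
  have e2 : k + 3 + ℓ - 3 = k + ℓ := by omega
  have e3 : ((k + 3 : ℕ) : ℝ) - 2 = k + 1 := by push_cast; ring
  have e4 : ((k + 3 : ℕ) : ℝ) + 2 * ℓ - 2 = k + 1 + 2 * ℓ := by push_cast; ring
  rw [Aconst, e1, e2, e3, e4, sq_sqrt (by positivity), div_mul_eq_mul_div,
    div_le_iff₀ (by positivity)]
  push_cast
  calc _ ≤ (Nat.factorial k * Nat.factorial ℓ * (4 * (k + 1)) * (2 * (k + 1)) ^ ℓ : ℝ) := by
        gcongr <;> linarith
    _ = 4 * 2 ^ ℓ * Nat.factorial ℓ * ((Nat.factorial k * (k + 1) ^ ℓ) * (k + 1)) := by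
        rw [mul_pow]; ring
    _ ≤ _ := by gcongr

theorem stmt14 (ℓ : ℕ) (hodd : Odd ℓ) (hl : 1 ≤ ℓ) :
    ∃ c > (0 : ℝ), ∃ N : ℕ, ∀ n : ℕ, ∀ hn3 : 3 ≤ n, ∀ hn : N ≤ n,
      (Aconst n ℓ) ^ 4 * ((n : ℝ) - 2) ^ 4 *
          (∫ x : Metric.sphere (0 : EuclideanSpace ℝ (Fin n)) 1,
            (gegenbauer ((n : ℝ) / 2) (ℓ - 1) ((x : EuclideanSpace ℝ (Fin n)) (⟨0, by omega⟩ : Fin n))) ^ 4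
            ∂(sphereUniform (Fin n)))
        ≤ c * (n : ℝ) ^ 2 := by
  obtain ⟨K, hK, hbound⟩ := integral_gegenbauer_pow_four_le (ℓ - 1)
  refine ⟨(4 * 2 ^ ℓ * Nat.factorial ℓ) ^ 2 * K, by positivity, 2 * ℓ + 2, fun n hn3 hn ↦ ?_⟩
  have hI := hbound (⟨0, by omega⟩ : Fin n) (by simp; omega)
  rw [Fintype.card_fin] at hI
  have hA := Aconst_sq_mul_pow_le (n := n) (ℓ := ℓ) (by omega) (by omega)
  have hn2 : (0 : ℝ) ≤ n - 2 := by
    have : (3 : ℝ) ≤ n := by exact_mod_cast hn3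
    linarith
  have hexp : (n : ℝ) ^ 2 * n ^ (2 * (ℓ - 1)) = (n ^ ℓ) ^ 2 := by
    rw [← pow_add, ← pow_mul]; congr 1; omega
  calc _ ≤ Aconst n ℓ ^ 4 * (n : ℝ) ^ 4 * (K * (n : ℝ) ^ (2 * (ℓ - 1))) := by
        gcongr
        simp
    _ = Aconst n ℓ ^ 4 * ((n : ℝ) ^ 2 * n ^ (2 * (ℓ - 1))) * K * n ^ 2 := by ring
    _ = (Aconst n ℓ ^ 2 * n ^ ℓ) ^ 2 * K * n ^ 2 := by rw [hexp]; ring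
    _ ≤ _ := by gcongr

end
end

section
/- For every odd integer ℓ ≥ 1: 2^{ℓ−1} · Σ_{k=0}^{(ℓ−1)/2} Σ_{m=0}^{(ℓ−1)/2} [ (−1)^{k+m} Γ(ℓ − k − m − 1/2) ] / [ √π · 2^{2k+2m} · k! · m! · (ℓ−1−2k)! · (ℓ−1−2m)! ] = 1/(ℓ−1)!. -/
open Real Finset

/-- The quotient `Γ(x + n) / Γ(x)` is the rising factorial of `x`. -/
theorem Real.Gamma_add_natCast_eq_ascPochhammer_mul {x : ℝ} (hx : 0 < x) (n : ℕ) :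
    Real.Gamma (x + n) = (ascPochhammer ℝ n).eval x * Real.Gamma x := by
  induction n with
  | zero => simp
  | succ n ih =>
    have hxn : x + n ≠ 0 := by positivity
    rw [Nat.cast_succ, ← add_assoc, Real.Gamma_add_one hxn, ih, ascPochhammer_succ_eval]
    ring

/-- Legendre duplication at half-integers, in terms of factorials. -/
theorem Real.factorial_two_mul_mul_sqrt_pi (j : ℕ) :
    ((2 * j).factorial : ℝ) * √π = 4 ^ j * j.factorial * Real.Gamma (j + 1 / 2) := by
  induction j with
  | zero => simp [-one_div, Real.Gamma_one_half_eq]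
  | succ j ih =>
    have hj : (j : ℝ) + 1 / 2 ≠ 0 := by positivity
    rw [show ((j + 1 : ℕ) : ℝ) + 1 / 2 = (j + 1 / 2) + 1 by push_cast; ring,
      Real.Gamma_add_one hj, show 2 * (j + 1) = 2 * j + 1 + 1 by ring]
    simp only [Nat.factorial_succ]
    push_cast
    linear_combination ((2 * j + 2 : ℝ) * (2 * j + 1)) * ih

/-- The `p`-th finite difference of the rising factorial of degree `r ≤ p`. -/
theorem sum_neg_one_pow_mul_choose_mul_ascPochhammer {p r : ℕ} (hr : r ≤ p) (x : ℝ) :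
    ∑ j ∈ Finset.range (p + 1),
        (-1 : ℝ) ^ (p - j) * p.choose j * (ascPochhammer ℝ r).eval (x + j) =
      if r = p then (p.factorial : ℝ) else 0 := by
  have hsum := fwdDiff_iter_eq_sum_shift (1 : ℝ) (ascPochhammer ℝ r).eval p x
  have hdeg : (ascPochhammer ℝ r).natDegree = r := ascPochhammer_natDegree ℝ r
  have hval : (fwdDiff (1 : ℝ))^[p] (ascPochhammer ℝ r).eval x =
      if r = p then (p.factorial : ℝ) else 0 := by
    split_ifs with h
    · subst h
      have := congrFun (Polynomial.fwdDiff_iter_degree_eq_factorial (ascPochhammer ℝ r)) x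
      rw [hdeg, (monic_ascPochhammer ℝ r).leadingCoeff] at this
      simpa using this
    · have := Polynomial.fwdDiff_iter_eq_zero_of_degree_lt
        (P := ascPochhammer ℝ r) (n := p) (by omega)
      rw [this, Pi.zero_apply]
  rw [← hval, hsum]
  simp

/-- Orthogonality of the Hermite polynomial of degree `2 p` to the even monomials of smaller
degree, written out in terms of Gaussian moments. -/
theorem sum_neg_one_pow_mul_Gamma_div_factorial {p k : ℕ} (hk : k ≤ p) :
    ∑ m ∈ Finset.range (p + 1), (-1 : ℝ) ^ m * Real.Gamma (2 * p - k - m + 1 / 2) /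
        (4 ^ m * m.factorial * (2 * p - 2 * m).factorial) =
      if k = 0 then √π / 4 ^ p else 0 := by
  have hterm : ∀ j ∈ Finset.range (p + 1),
      (-1 : ℝ) ^ (p - j) * Real.Gamma (2 * p - k - (p - j : ℕ) + 1 / 2) /
        (4 ^ (p - j) * (p - j).factorial * (2 * p - 2 * (p - j)).factorial) =
      √π / (4 ^ p * p.factorial) * ((-1 : ℝ) ^ (p - j) * p.choose j *
        (ascPochhammer ℝ (p - k)).eval (1 / 2 + (j : ℝ))) := by
    intro j hj
    have hjp : j ≤ p := by simpa [Nat.lt_succ_iff] using hj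
    have hG : 0 < Real.Gamma (1 / 2 + (j : ℝ)) := Real.Gamma_pos_of_pos (by positivity)
    have hdup := Real.factorial_two_mul_mul_sqrt_pi j
    have hpi : 0 < √π := by positivity
    rw [show (2 * p - k - (p - j : ℕ) + 1 / 2 : ℝ) = (1 / 2 + (j : ℝ)) + (p - k : ℕ) by
        push_cast [Nat.cast_sub hjp, Nat.cast_sub hk]; ring,
      Real.Gamma_add_natCast_eq_ascPochhammer_mul (by positivity),
      show 2 * p - 2 * (p - j) = 2 * j by omega, Nat.cast_choose ℝ hjp,
      ← pow_sub_mul_pow (4 : ℝ) hjp]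
    rw [add_comm (j : ℝ)] at hdup
    have hj0 : (j.factorial : ℝ) ≠ 0 := by positivity
    have hp0 : (p.factorial : ℝ) ≠ 0 := by positivity
    have hpj0 : ((p - j).factorial : ℝ) ≠ 0 := by positivity
    have h2j0 : ((2 * j).factorial : ℝ) ≠ 0 := by positivity
    generalize Real.Gamma (1 / 2 + (j : ℝ)) = G at *
    generalize (ascPochhammer ℝ (p - k)).eval (1 / 2 + (j : ℝ)) = P at *
    rw [div_mul_eq_mul_div, div_eq_div_iff (by positivity) (by positivity)]
    field_simp
    linear_combination (-P) * hdup
  rw [← Finset.sum_flip, Finset.sum_congr rfl hterm, ← Finset.mul_sum,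
    sum_neg_one_pow_mul_choose_mul_ascPochhammer (Nat.sub_le p k)]
  have hp0 : (p.factorial : ℝ) ≠ 0 := by positivity
  by_cases h : k = 0
  · subst h
    simp only [Nat.sub_zero, if_true]
    field_simp
  · rw [if_neg (by omega), if_neg h, mul_zero]

theorem stmt15 (ℓ : ℕ) (hodd : Odd ℓ) (hl : 1 ≤ ℓ) :
    (2 : ℝ) ^ (ℓ - 1) *
      ∑ k ∈ Finset.range ((ℓ - 1) / 2 + 1), ∑ m ∈ Finset.range ((ℓ - 1) / 2 + 1),
        ((-1 : ℝ) ^ (k + m) * Real.Gamma ((ℓ : ℝ) - k - m - 1 / 2)) /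
          (Real.sqrt π * 2 ^ (2 * k + 2 * m) * (Nat.factorial k) * (Nat.factorial m) *
            (Nat.factorial (ℓ - 1 - 2 * k)) * (Nat.factorial (ℓ - 1 - 2 * m)))
      = 1 / (Nat.factorial (ℓ - 1)) := by
  obtain ⟨p, rfl⟩ := hodd
  have hpi : √π ≠ 0 := by positivity
  simp only [Nat.add_sub_cancel, Nat.mul_div_cancel_left p two_pos]
  have hinner : ∀ k ∈ Finset.range (p + 1), ∑ m ∈ Finset.range (p + 1),
        ((-1 : ℝ) ^ (k + m) * Real.Gamma (((2 * p + 1 : ℕ) : ℝ) - k - m - 1 / 2)) /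
          (√π * 2 ^ (2 * k + 2 * m) * (Nat.factorial k) * (Nat.factorial m) *
            (Nat.factorial (2 * p - 2 * k)) * (Nat.factorial (2 * p - 2 * m))) =
      (-1 : ℝ) ^ k / (√π * 4 ^ k * k.factorial * (2 * p - 2 * k).factorial) *
        if k = 0 then √π / 4 ^ p else 0 := by
    intro k hk
    rw [← sum_neg_one_pow_mul_Gamma_div_factorial (Nat.lt_succ_iff.mp (Finset.mem_range.mp hk)),
      Finset.mul_sum]
    refine Finset.sum_congr rfl fun m _ => ?_
    rw [show ((2 * p + 1 : ℕ) : ℝ) - k - m - 1 / 2 = 2 * p - k - m + 1 / 2 by push_cast; ring,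
      div_mul_div_comm, pow_add, pow_add, pow_mul, pow_mul]
    norm_num only
    congr 1 <;> ring
  rw [Finset.sum_congr rfl hinner, Finset.sum_eq_single_of_mem 0 (by simp)
    (fun k _ hk => by rw [if_neg hk, mul_zero])]
  have h0 : ((2 * p).factorial : ℝ) ≠ 0 := by positivity
  rw [pow_mul]
  norm_num only [if_true, pow_zero, Nat.factorial_zero, Nat.mul_zero, Nat.sub_zero, Nat.cast_one]
  field_simp
end

section
/- For all integers p ≥ 0 and k with 0 ≤ k ≤ p: Σ_{m=0}^{p} (−1)^m (4p − 2k − 2m)! / ( m! (2p − 2m)! (2p − k − m)! ) equals 2^{2p} if k = 0, and equals 0 if 1 ≤ k ≤ p. -/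
open Finset

open Polynomial in
/-- Comparing coefficients in `((1 + X) ^ 2 - 1) ^ n = X ^ n * (X + 2) ^ n`. -/
theorem sum_neg_one_pow_mul_choose_mul_choose {R : Type*} [CommRing R] (n j : ℕ) :
    ∑ m ∈ range (n + 1), (-1 : R) ^ m * n.choose m * (2 * (n - m)).choose j
      = ((X : R[X]) ^ n * (X + C 2) ^ n).coeff j := by
  have h : (X : R[X]) ^ n * (X + C 2) ^ n = (C (-1) + (1 + X) ^ 2) ^ n := by
    rw [← mul_pow]
    congr 1
    simp only [map_neg, map_one, C_ofNat]
    ring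
  rw [h, add_pow, finsetSum_coeff]
  refine sum_congr rfl fun m _ => ?_
  rw [← pow_mul, ← C_pow, ← C_eq_natCast, coeff_mul_C, coeff_C_mul,
    coeff_one_add_X_pow]
  ring

theorem stmt16 (p k : ℕ) (hk : k ≤ p) :
    ∑ m ∈ Finset.range (p + 1),
        ((-1 : ℝ) ^ m * (Nat.factorial (4 * p - 2 * k - 2 * m))) /
          ((Nat.factorial m) * (Nat.factorial (2 * p - 2 * m)) *
            (Nat.factorial (2 * p - k - m)))
      = if k = 0 then (2 : ℝ) ^ (2 * p) else 0 := by
  have key := sum_neg_one_pow_mul_choose_mul_choose (R := ℝ) (2 * p - k) (2 * p - 2 * k)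
  have hsub : range (p + 1) ⊆ range (2 * p - k + 1) := range_subset_range.2 (by omega)
  rw [← sum_subset hsub fun m hm hmp => by
    simp only [mem_range] at hm hmp
    rw [Nat.choose_eq_zero_of_lt (by omega : 2 * (2 * p - k - m) < 2 * p - 2 * k)]
    simp] at key
  have hterm : ∀ m ∈ range (p + 1),
      ((-1 : ℝ) ^ m * (Nat.factorial (4 * p - 2 * k - 2 * m))) /
          ((Nat.factorial m) * (Nat.factorial (2 * p - 2 * m)) *
            (Nat.factorial (2 * p - k - m)))
        = ((2 * p - 2 * k).factorial / (2 * p - k).factorial : ℝ) *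
          ((-1 : ℝ) ^ m * (2 * p - k).choose m *
            (2 * (2 * p - k - m)).choose (2 * p - 2 * k)) := by
    intro m hm
    rw [mem_range] at hm
    rw [Nat.cast_choose ℝ (by omega : m ≤ 2 * p - k),
      Nat.cast_choose ℝ (by omega : 2 * p - 2 * k ≤ 2 * (2 * p - k - m)),
      show 2 * (2 * p - k - m) - (2 * p - 2 * k) = 2 * p - 2 * m by omega,
      show 2 * (2 * p - k - m) = 4 * p - 2 * k - 2 * m by omega]
    field_simp
  rw [sum_congr rfl hterm, ← mul_sum, key, Polynomial.coeff_X_pow_mul']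
  split_ifs with h₁ h₂ h₂
  · subst h₂
    simp [Polynomial.coeff_X_add_C_pow, Nat.factorial_ne_zero]
  · omega
  · omega
  · simp
end
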